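/- arXiv:0911.3803 — 2 statements merged into one kernel-verified Lean document; each statement's English description precedes it below -/
import Mathlib

section
/- Let G be a rayless graph. Then either G has no strong twin, or there exist infinitely many pairwise non-isomorphic graphs each of which is a strong twin of G. -/
/-- A graph is rayless if it contains no ray, i.e. no infinite sequence of distinct
vertices `v₀, v₁, v₂, …` with `vᵢ` adjacent to `vᵢ₊₁` for all `i`. -/
def SimpleGraph.IsRayless {V : Type*} (G : SimpleGraph V) : Prop :=
  ¬ ∃ f : ℕ → V, Function.Injective f ∧ ∀ n, G.Adj (f n) (f (n + 1))

/-- Two graphs are strong twins if they are non-isomorphic and each embeds into the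
other (as an induced subgraph). -/
def SimpleGraph.StrongTwins {V W : Type*} (G : SimpleGraph V) (H : SimpleGraph W) : Prop :=
  ¬ Nonempty (G ≃g H) ∧ Nonempty (G ↪g H) ∧ Nonempty (H ↪g G)

universe u


namespace RT

universe v

section Rank

variable {V : Type v} {W : Type v}

/-- Reachability inside a set of vertices. -/
def Rch (G : SimpleGraph V) (X : Set V) : V → V → Prop :=
  Relation.ReflTransGen (fun x y => G.Adj x y ∧ x ∈ X ∧ y ∈ X)

/-- A nonempty connected set of vertices. -/
def IsC (G : SimpleGraph V) (X : Set V) : Prop :=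
  X.Nonempty ∧ ∀ a ∈ X, ∀ b ∈ X, Rch G X a b

theorem Rch.symm {G : SimpleGraph V} {X : Set V} {a b : V} (h : Rch G X a b) :
    Rch G X b a := by
  induction h with
  | refl => exact Relation.ReflTransGen.refl
  | tail _ h ih => exact Relation.ReflTransGen.head ⟨h.1.symm, h.2.2, h.2.1⟩ ih

theorem Rch.mono {G : SimpleGraph V} {X Y : Set V} (hXY : X ⊆ Y) {a b : V} (h : Rch G X a b) :
    Rch G Y a b := by
  induction h with
  | refl => exact Relation.ReflTransGen.refl
  | tail _ h ih => exact Relation.ReflTransGen.tail ih ⟨h.1, hXY h.2.1, hXY h.2.2⟩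

/-- The component of `a` inside `X`. -/
def Cmp (G : SimpleGraph V) (X : Set V) (a : V) : Set V := {b | b ∈ X ∧ Rch G X a b}

theorem rch_cmp {G : SimpleGraph V} {X : Set V} {a b : V} (h : Rch G X a b) :
    Rch G (Cmp G X a) a b := by
  induction h with
  | refl => exact Relation.ReflTransGen.refl
  | @tail b c hab h ih =>
    exact Relation.ReflTransGen.tail ih ⟨h.1, ⟨h.2.1, hab⟩, ⟨h.2.2, hab.tail h⟩⟩

theorem isC_cmp {G : SimpleGraph V} {X : Set V} {a : V} (ha : a ∈ X) : IsC G (Cmp G X a) :=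
  ⟨⟨a, ha, Relation.ReflTransGen.refl⟩, fun _ hb _ hc =>
    Relation.ReflTransGen.trans (Rch.symm (rch_cmp hb.2)) (rch_cmp hc.2)⟩

theorem IsC.image {G : SimpleGraph V} {H : SimpleGraph W} (f : V → W)
    (hf : ∀ x y, G.Adj x y → H.Adj (f x) (f y)) {X : Set V} (h : IsC G X) : IsC H (f '' X) := by
  refine ⟨h.1.image f, ?_⟩
  rintro _ ⟨a, ha, rfl⟩ _ ⟨b, hb, rfl⟩
  have key : ∀ c, Rch G X a c → Rch H (f '' X) (f a) (f c) := by
    intro c hc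
    induction hc with
    | refl => exact Relation.ReflTransGen.refl
    | tail _ h ih =>
      exact Relation.ReflTransGen.tail ih ⟨hf _ _ h.1, ⟨_, h.2.1, rfl⟩, ⟨_, h.2.2, rfl⟩⟩
  exact key b (h.2 a ha b hb)

/-- The rank of a set of vertices is at most the given ordinal. -/
inductive Rk (G : SimpleGraph V) : Ordinal.{v} → Set V → Prop
  | mk (α : Ordinal.{v}) (X S : Set V) (hS : S.Finite) (γ : Set V → Ordinal.{v})
      (hγ : ∀ Y, Y ⊆ X \ S → IsC G Y → γ Y < α)
      (h : ∀ Y, Y ⊆ X \ S → IsC G Y → Rk G (γ Y) Y) : Rk G α X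

/-- `S` is a finite set whose deletion leaves only pieces of rank below `α`. -/
def Good (G : SimpleGraph V) (α : Ordinal.{v}) (X S : Set V) : Prop :=
  S.Finite ∧ ∀ Y, Y ⊆ X \ S → IsC G Y → ∃ γ, γ < α ∧ Rk G γ Y

theorem rk_iff {G : SimpleGraph V} {α : Ordinal.{v}} {X : Set V} :
    Rk G α X ↔ ∃ S, Good G α X S := by
  classical
  constructor
  · rintro ⟨_, _, S, hS, γ, hγ, h⟩
    exact ⟨S, hS, fun Y h1 h2 => ⟨γ Y, hγ Y h1 h2, h Y h1 h2⟩⟩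
  · rintro ⟨S, hS, h⟩
    choose! γ h1 h2 using h
    exact Rk.mk α X S hS γ h1 h2

theorem Good.pull {G : SimpleGraph V} {H : SimpleGraph W} (f : V → W)
    (hinj : Function.Injective f)
    (hf : ∀ x y, G.Adj x y → H.Adj (f x) (f y)) {α : Ordinal.{v}} {X : Set V} {Y S : Set W}
    (ih : ∀ γ < α, ∀ (X : Set V) (Y : Set W), f '' X ⊆ Y → Rk H γ Y → Rk G γ X)
    (hXY : f '' X ⊆ Y) (h : Good H α Y S) : Good G α X (f ⁻¹' S) := by
  refine ⟨h.1.preimage hinj.injOn, fun Z hZ hc => ?_⟩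
  obtain ⟨γ, hγ, hr⟩ := h.2 (f '' Z) (by
    rintro _ ⟨z, hz, rfl⟩
    exact ⟨hXY ⟨z, (hZ hz).1, rfl⟩, (hZ hz).2⟩) (hc.image f hf)
  exact ⟨γ, hγ, ih γ hγ _ _ subset_rfl hr⟩

theorem Rk.pull {G : SimpleGraph V} {H : SimpleGraph W} (f : V → W)
    (hinj : Function.Injective f)
    (hf : ∀ x y, G.Adj x y → H.Adj (f x) (f y)) (α : Ordinal.{v}) :
    ∀ (X : Set V) (Y : Set W), f '' X ⊆ Y → Rk H α Y → Rk G α X := by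
  induction α using WellFoundedLT.induction with
  | ind α ih =>
    intro X Y hXY h
    obtain ⟨S, hS⟩ := rk_iff.1 h
    exact rk_iff.2 ⟨_, hS.pull f hinj hf ih hXY⟩

theorem Rk.mono {G : SimpleGraph V} {α β : Ordinal.{v}} {X Y : Set V} (hXY : X ⊆ Y) (hab : α ≤ β)
    (h : Rk G α Y) : Rk G β X := by
  obtain ⟨S, hS, h⟩ := rk_iff.1 h
  refine rk_iff.2 ⟨S, hS, fun Z hZ hc => ?_⟩
  obtain ⟨γ, hγ, hr⟩ := h Z (fun z hz => ⟨hXY (hZ hz).1, (hZ hz).2⟩) hc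
  exact ⟨γ, hγ.trans_le hab, hr⟩

/-- From a vertex of a connected set one can reach a vertex of a nonempty target set by a path
all of whose earlier vertices are off the target. -/
theorem first_hit {G : SimpleGraph V} {X T : Set V} {a b : V} (ha : a ∈ X) (hb : b ∈ T)
    (h : Rch G X a b) : ∃ t ∈ T, t ∈ X ∧ Rch G ((X \ T) ∪ {t}) a t := by
  classical
  induction h using Relation.ReflTransGen.head_induction_on with
  | refl => exact ⟨b, hb, ha, Relation.ReflTransGen.refl⟩
  | @head a c hac _ ih =>
    by_cases haT : a ∈ T
    · exact ⟨a, haT, ha, Relation.ReflTransGen.refl⟩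
    · obtain ⟨t, ht, htX, hr⟩ := ih hac.2.2
      refine ⟨t, ht, htX, ?_⟩
      have hcm : c ∈ (X \ T) ∪ {t} := by
        rcases Relation.ReflTransGen.cases_head hr with h | ⟨d, h, _⟩
        · right; exact h
        · exact h.2.1
      exact Relation.ReflTransGen.head ⟨hac.1, Or.inl ⟨ha, haT⟩, hcm⟩ hr

theorem Good.inter {G : SimpleGraph V} {α : Ordinal.{v}} {X S T : Set V}
    (hS : Good G α X S) (hT : Good G α X T) : Good G α X (S ∩ T) := by
  classical
  refine ⟨hS.1.subset Set.inter_subset_left, fun Y hY hc => ?_⟩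
  by_cases hne : (Y ∩ (S ∪ T)).Nonempty
  swap
  · refine hS.2 Y (fun y hy => ⟨(hY hy).1, fun hyS => hne ⟨y, hy, Or.inl hyS⟩⟩) hc
  -- the pieces
  let U : V → Set V := fun s => if s ∈ S then Y \ T else Y \ S
  have hU : ∀ s ∈ Y ∩ (S ∪ T), s ∈ U s := by
    rintro s ⟨hsY, hs⟩
    have := (hY hsY).2
    by_cases h : s ∈ S
    · simp only [U, h, if_true]; exact ⟨hsY, fun ht => this ⟨h, ht⟩⟩
    · simp only [U, h, if_false]; exact ⟨hsY, h⟩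
  have hex : ∀ s ∈ Y ∩ (S ∪ T), ∃ γ, γ < α ∧ Rk G γ (Cmp G (U s) s) := by
    intro s hs
    have hc := isC_cmp (G := G) (hU s hs)
    by_cases h : s ∈ S
    · refine hT.2 _ (fun y hy => ?_) hc
      have := hy.1
      simp only [U, h, if_true] at this
      exact ⟨(hY this.1).1, this.2⟩
    · refine hS.2 _ (fun y hy => ?_) hc
      have := hy.1
      simp only [U, h, if_false] at this
      exact ⟨(hY this.1).1, this.2⟩
  choose! γ hγ hr using hex
  have hr' : ∀ s ∈ Y ∩ (S ∪ T), ∃ A, Good G (γ s) (Cmp G (U s) s) A :=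
    fun s hs => rk_iff.1 (hr s hs)
  choose! A hA using hr'
  have hfin : (Y ∩ (S ∪ T)).Finite := (hS.1.union hT.1).subset Set.inter_subset_right
  obtain ⟨m, hm, hmax⟩ := Set.exists_max_image _ γ hfin hne
  refine ⟨γ m, hγ m hm, rk_iff.2 ⟨(S ∪ T) ∪ ⋃ s ∈ Y ∩ (S ∪ T), A s, ?_, ?_⟩⟩
  · exact (hS.1.union hT.1).union (hfin.biUnion fun s hs => (hA s hs).1)
  · intro Z hZ hZc
    obtain ⟨w, hw⟩ := hZc.1
    obtain ⟨b, hbY, hb⟩ := hne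
    obtain ⟨s, hsT, hsY, hreach⟩ := first_hit (hZ hw).1 hb (hc.2 w (hZ hw).1 b hbY)
    have hs : s ∈ Y ∩ (S ∪ T) := ⟨hsY, hsT⟩
    have hsub : (Y \ (S ∪ T)) ⊆ U s := by
      rintro y ⟨hy, hn⟩
      by_cases h : s ∈ S
      · simp only [U, h, if_true]; exact ⟨hy, fun h => hn (Or.inr h)⟩
      · simp only [U, h, if_false]; exact ⟨hy, fun h => hn (Or.inl h)⟩
    have hZs : Z ⊆ Y \ (S ∪ T) := fun z hz => ⟨(hZ hz).1, fun h => (hZ hz).2 (Or.inl h)⟩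
    have h1 : Rch G (U s) s w := by
      refine Rch.symm (Rch.mono ?_ hreach)
      rintro y (hy | rfl)
      · exact hsub hy
      · exact hU _ hs
    have hZU : Z ⊆ Cmp G (U s) s := fun z hz =>
      ⟨hsub (hZs hz), h1.trans (Rch.mono (hZs.trans hsub) (hZc.2 w hw z hz))⟩
    obtain ⟨δ, hδ, hrδ⟩ := (hA s hs).2 Z (fun z hz => ⟨hZU hz, fun h =>
      (hZ hz).2 (Or.inr (Set.mem_biUnion hs h))⟩) hZc
    exact ⟨δ, hδ.trans_le (hmax s hs), hrδ⟩

theorem exists_kernel {G : SimpleGraph V} {α : Ordinal.{v}} {X : Set V} (h : Rk G α X) :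
    ∃ K, Good G α X K ∧ ∀ T, Good G α X T → K ⊆ T := by
  classical
  obtain ⟨S, hS⟩ := rk_iff.1 h
  have hex : ∃ n, ∃ S, Good G α X S ∧ S.ncard = n := ⟨_, S, hS, rfl⟩
  obtain ⟨K, hK, hn⟩ := Nat.find_spec hex
  refine ⟨K, hK, fun T hT => ?_⟩
  have h1 : Nat.find hex ≤ (K ∩ T).ncard := Nat.find_min' hex ⟨_, hK.inter hT, rfl⟩
  rw [← hn] at h1
  have := Set.eq_of_subset_of_ncard_le Set.inter_subset_left h1 hK.1
  exact this ▸ Set.inter_subset_right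

theorem kernel_self {G : SimpleGraph V} {α : Ordinal.{v}} {K : Set V}
    (hK : Good G α Set.univ K) (hmin : ∀ T, Good G α Set.univ T → K ⊆ T)
    (f : V → V) (hinj : Function.Injective f) (hf : ∀ x y, G.Adj x y → G.Adj (f x) (f y)) :
    ∀ k ∈ K, f k ∈ K := by
  have := hK.pull f hinj hf (X := Set.univ) (fun γ _ => Rk.pull f hinj hf γ) (Set.subset_univ _)
  exact fun k hk => hmin _ this hk

/-- Two self-embeddings of a connected ranked graph cannot have disjoint images. -/
theorem no_two {G : SimpleGraph V} {α : Ordinal.{v}} (h : Rk G α Set.univ)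
    (hc : IsC G Set.univ) (f g : V → V) (hfi : Function.Injective f) (hgi : Function.Injective g)
    (hf : ∀ x y, G.Adj x y → G.Adj (f x) (f y)) (hg : ∀ x y, G.Adj x y → G.Adj (g x) (g y)) :
    ∃ x y, f x = g y := by
  classical
  induction α using WellFoundedLT.induction with
  | ind α ih =>
    by_cases hβ : ∃ β < α, Rk G β Set.univ
    · obtain ⟨β, hβ, hr⟩ := hβ
      exact ih β hβ hr
    obtain ⟨K, hK, hmin⟩ := exists_kernel h
    have hne : K.Nonempty := by
      by_contra hne
      rw [Set.not_nonempty_iff_eq_empty] at hne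
      obtain ⟨γ, h1, h2⟩ := hK.2 Set.univ (by simp [hne]) hc
      exact hβ ⟨γ, h1, h2⟩
    have h1 := kernel_self hK hmin f hfi hf
    have h2 := kernel_self hK hmin g hgi hg
    obtain ⟨k, hk⟩ := hne
    have hs : f '' K = K :=
      Set.eq_of_subset_of_ncard_le (Set.image_subset_iff.2 h1)
        (Set.ncard_image_of_injective K hfi).ge hK.1
    obtain ⟨x, _, hx⟩ := hs.ge (h2 k hk)
    exact ⟨x, k, hx⟩

theorem bad_step {G : SimpleGraph V} {X : Set V} (h : ∀ α, ¬ Rk G α X) {S : Set V}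
    (hS : S.Finite) : ∃ Y, Y ⊆ X \ S ∧ IsC G Y ∧ ∀ α, ¬ Rk G α Y := by
  classical
  by_contra hcon
  push Not at hcon
  choose! γ hγ using hcon
  refine h (Order.succ (⨆ Y, γ Y)) (rk_iff.2 ⟨S, hS, fun Y h1 h2 => ⟨γ Y, ?_, hγ Y h1 h2⟩⟩)
  exact Order.lt_succ_of_le (Ordinal.le_iSup γ Y)

theorem bad_next {G : SimpleGraph V} {Y : Set V} {v : V} (hv : v ∈ Y) (hc : IsC G Y)
    (h : ∀ α, ¬ Rk G α Y) :
    ∃ Y' v', v' ∈ Y' ∧ IsC G Y' ∧ (∀ α, ¬ Rk G α Y') ∧ Y' ⊆ Y ∧ v ∉ Y' ∧ G.Adj v v' := by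
  obtain ⟨Z, hZ, hZc, hZb⟩ := bad_step h (Set.finite_singleton v)
  obtain ⟨w, hw⟩ := hZc.1
  have hwY := hZ hw
  obtain ⟨t, ht, _, hr⟩ := first_hit (T := {v}) hwY.1 (Set.mem_singleton v) (hc.2 w hwY.1 v hv)
  obtain rfl : t = v := ht
  -- the vertex before `v`
  have key : ∀ b, Rch G ((Y \ {t}) ∪ {t}) w b →
      (Rch G (Y \ {t}) w b ∧ b ∈ Y \ {t}) ∨
      ∃ c, Rch G (Y \ {t}) w c ∧ c ∈ Y \ {t} ∧ G.Adj t c := by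
    intro b hb
    induction hb with
    | refl => exact Or.inl ⟨Relation.ReflTransGen.refl, hwY⟩
    | @tail b c hab hbc ih =>
      rcases ih with ⟨h1, h2⟩ | h
      · rcases hbc.2.2 with h3 | h3
        · exact Or.inl ⟨h1.tail ⟨hbc.1, h2, h3⟩, h3⟩
        · obtain rfl : c = t := h3
          exact Or.inr ⟨b, h1, h2, hbc.1.symm⟩
      · exact Or.inr h
  rcases key t hr with ⟨_, h2⟩ | ⟨c, h1, h2, h3⟩
  · exact absurd rfl h2.2
  · refine ⟨Cmp G (Y \ {t}) w, c, ⟨h2, h1⟩, isC_cmp hwY, fun α hα => hZb α (hα.mono ?_ le_rfl),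
      fun y hy => hy.1.1, fun h => h.1.2 rfl, h3⟩
    exact fun z hz => ⟨hZ hz, Rch.mono hZ (hZc.2 w hw z hz)⟩

theorem exists_rank {G : SimpleGraph V}
    (hG : ¬ ∃ f : ℕ → V, Function.Injective f ∧ ∀ n, G.Adj (f n) (f (n + 1))) :
    ∃ α, Rk G α Set.univ := by
  classical
  by_contra hcon
  push Not at hcon
  apply hG
  obtain ⟨Y, _, hYc, hYb⟩ := bad_step hcon Set.finite_empty
  obtain ⟨v, hv⟩ := hYc.1
  let St := {p : Set V × V // p.2 ∈ p.1 ∧ IsC G p.1 ∧ ∀ α, ¬ Rk G α p.1}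
  have hstep : ∀ p : St, ∃ q : St, q.1.1 ⊆ p.1.1 ∧ p.1.2 ∉ q.1.1 ∧ G.Adj p.1.2 q.1.2 := by
    rintro ⟨⟨Y, v⟩, hv, hc, hb⟩
    obtain ⟨Y', v', h1, h2, h3, h4, h5, h6⟩ := bad_next hv hc hb
    exact ⟨⟨⟨Y', v'⟩, h1, h2, h3⟩, h4, h5, h6⟩
  choose nx hnx using hstep
  let s : ℕ → St := fun n => Nat.rec ⟨⟨Y, v⟩, hv, hYc, hYb⟩ (fun _ p => nx p) n
  have hs : ∀ n, s (n + 1) = nx (s n) := fun n => rfl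
  have hanti : Antitone (fun n => (s n).1.1) :=
    antitone_nat_of_succ_le fun n => by rw [hs]; exact (hnx (s n)).1
  have hlt : ∀ m n, m < n → (s m).1.2 ≠ (s n).1.2 := by
    intro m n hmn he
    have h1 := (hnx (s m)).2.1
    rw [← hs] at h1
    exact h1 (hanti (show m + 1 ≤ n from hmn) (he ▸ (s n).2.1))
  refine ⟨fun n => (s n).1.2, fun m n h => ?_, fun n => ?_⟩
  · rcases lt_trichotomy m n with h' | h' | h'
    · exact absurd h (hlt _ _ h')
    · exact h'
    · exact absurd h.symm (hlt _ _ h')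
  · show G.Adj (s n).1.2 (s (n + 1)).1.2
    rw [hs]; exact (hnx (s n)).2.2

end Rank

/-- Vertex-coloured graphs. -/
structure CG (ι : Type) : Type (v + 1) where
  V : Type v
  G : SimpleGraph V
  c : V → ι

variable {ι : Type}

/-- Colour preserving induced embeddings. -/
structure Emb (A B : CG.{v} ι) where
  f : A.V → B.V
  inj : Function.Injective f
  adj : ∀ x y, B.G.Adj (f x) (f y) ↔ A.G.Adj x y
  col : ∀ x, B.c (f x) = A.c x

/-- The identity embedding. -/
def Emb.id (A : CG.{v} ι) : Emb A A := ⟨fun x => x, fun _ _ h => h, fun _ _ => Iff.rfl, fun _ => rfl⟩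

/-- Composition, first `e` then `g`. -/
def Emb.comp {A B C : CG.{v} ι} (g : Emb B C) (e : Emb A B) : Emb A C :=
  ⟨fun x => g.f (e.f x), fun _ _ h => e.inj (g.inj h), fun x y => (g.adj _ _).trans (e.adj x y),
    fun x => (g.col _).trans (e.col x)⟩

/-- Embeddability. -/
def Le (A B : CG.{v} ι) : Prop := Nonempty (Emb A B)

/-- Isomorphism. -/
def Iso (A B : CG.{v} ι) : Prop := ∃ e : Emb A B, Function.Surjective e.f

/-- Mutual embeddability. -/
def Eqm (A B : CG.{v} ι) : Prop := Le A B ∧ Le B A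

theorem Le.refl (A : CG.{v} ι) : Le A A := ⟨Emb.id A⟩

theorem Le.trans {A B C : CG.{v} ι} (h : Le A B) (h' : Le B C) : Le A C :=
  h.elim fun e => h'.elim fun g => ⟨g.comp e⟩

theorem Emb.exists_inv {A B : CG.{v} ι} (e : Emb A B) (h : Function.Surjective e.f) :
    ∃ g : Emb B A, Function.Surjective g.f ∧ (∀ x, g.f (e.f x) = x) ∧ ∀ y, e.f (g.f y) = y := by
  choose g hg using h
  have hge : ∀ x, g (e.f x) = x := fun x => e.inj (hg _)
  refine ⟨⟨g, fun x y h => ?_, fun x y => ?_, fun x => ?_⟩, fun x => ⟨e.f x, hge x⟩, hge, hg⟩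
  · rw [← hg x, ← hg y, h]
  · rw [← e.adj, hg, hg]
  · rw [← e.col, hg]

theorem Iso.refl (A : CG.{v} ι) : Iso A A := ⟨Emb.id A, fun x => ⟨x, rfl⟩⟩

theorem Iso.symm {A B : CG.{v} ι} (h : Iso A B) : Iso B A := by
  obtain ⟨e, he⟩ := h
  obtain ⟨g, hg, _⟩ := e.exists_inv he
  exact ⟨g, hg⟩

theorem Iso.trans {A B C : CG.{v} ι} (h : Iso A B) (h' : Iso B C) : Iso A C := by
  obtain ⟨e, he⟩ := h
  obtain ⟨g, hg⟩ := h'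
  exact ⟨g.comp e, hg.comp he⟩

theorem Iso.le {A B : CG.{v} ι} (h : Iso A B) : Le A B := h.elim fun e _ => ⟨e⟩

theorem Iso.eqm {A B : CG.{v} ι} (h : Iso A B) : Eqm A B := ⟨h.le, h.symm.le⟩

theorem Eqm.refl (A : CG.{v} ι) : Eqm A A := ⟨Le.refl A, Le.refl A⟩

theorem Eqm.symm {A B : CG.{v} ι} (h : Eqm A B) : Eqm B A := ⟨h.2, h.1⟩

theorem Eqm.trans {A B C : CG.{v} ι} (h : Eqm A B) (h' : Eqm B C) : Eqm A C :=
  ⟨h.1.trans h'.1, h'.2.trans h.2⟩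

/-- There are infinitely many pairwise non-isomorphic graphs in the class `S` mutually embeddable
with `A`. -/
def Inf (S : CG.{v} ι → Prop) (A : CG.{v} ι) : Prop :=
  ∃ F : ℕ → CG.{v} ι, (∀ i j, i ≠ j → ¬ Iso (F i) (F j)) ∧ ∀ i, S (F i) ∧ Eqm A (F i)

/-- Every graph in the class `S` mutually embeddable with `A` is isomorphic to it. -/
def Uniq (S : CG.{v} ι → Prop) (A : CG.{v} ι) : Prop := ∀ B : CG.{v} ι, S B → Eqm A B → Iso A B

/-- The alternative within the class `S`. -/
def Alt (S : CG.{v} ι → Prop) (A : CG.{v} ι) : Prop := Uniq S A ∨ Inf S A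

theorem Inf.congr {S : CG.{v} ι → Prop} {A B : CG.{v} ι} (h : Eqm A B) (hA : Inf S A) :
    Inf S B := by
  obtain ⟨F, h1, h2⟩ := hA
  exact ⟨F, h1, fun i => ⟨(h2 i).1, h.symm.trans (h2 i).2⟩⟩

theorem Uniq.congr {S : CG.{v} ι → Prop} {A B : CG.{v} ι} (h : Iso A B) (hA : Uniq S A) :
    Uniq S B :=
  fun C hS hC => h.symm.trans (hA C hS (h.eqm.trans hC))

theorem Alt.congr {S : CG.{v} ι → Prop} {A B : CG.{v} ι} (h : Iso A B) (hA : Alt S A) : Alt S B :=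
  hA.imp (Uniq.congr h) (Inf.congr h.eqm)

/-- Embeddings with disjoint non-adjacent images. -/
def Apart {A B C : CG.{v} ι} (e : Emb A C) (g : Emb B C) : Prop :=
  ∀ x y, e.f x ≠ g.f y ∧ ¬ C.G.Adj (e.f x) (g.f y)

theorem Apart.symm {A B C : CG.{v} ι} {e : Emb A C} {g : Emb B C} (h : Apart e g) : Apart g e :=
  fun x y => ⟨(h y x).1.symm, fun h' => (h y x).2 h'.symm⟩

theorem Apart.comp {A B C D A' B' : CG.{v} ι} {e : Emb A C} {g : Emb B C} (h : Apart e g)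
    (k : Emb C D) (a : Emb A' A) (b : Emb B' B) :
    Apart (k.comp (e.comp a)) (k.comp (g.comp b)) :=
  fun _ _ => ⟨fun h' => (h _ _).1 (k.inj h'), fun h' => (h _ _).2 ((k.adj _ _).1 h')⟩

/-- Disjoint unions. -/
def DU {I : Type v} (C : I → CG.{v} ι) : CG.{v} ι where
  V := Σ i, (C i).V
  G :=
    { Adj := fun a b => ∃ i x y, a = ⟨i, x⟩ ∧ b = ⟨i, y⟩ ∧ (C i).G.Adj x y
      symm := by
        constructor
        rintro _ _ ⟨i, x, y, rfl, rfl, h⟩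
        exact ⟨i, y, x, rfl, rfl, h.symm⟩
      loopless := by
        constructor
        rintro _ ⟨i, x, y, h1, h2, h⟩
        have := h1.symm.trans h2
        simp only [Sigma.mk.injEq, heq_eq_eq, true_and] at this
        exact h.ne this }
  c := fun a => (C a.1).c a.2

theorem DU.adj_fst {I : Type v} {C : I → CG.{v} ι} {a b : (DU C).V} (h : (DU C).G.Adj a b) :
    a.1 = b.1 := by
  obtain ⟨i, x, y, rfl, rfl, h⟩ := h
  rfl

theorem DU.adj_mk {I : Type v} {C : I → CG.{v} ι} {i : I} {x y : (C i).V} :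
    (DU C).G.Adj ⟨i, x⟩ ⟨i, y⟩ ↔ (C i).G.Adj x y := by
  constructor
  · rintro ⟨j, x', y', h1, h2, h⟩
    obtain rfl : i = j := congrArg Sigma.fst h1
    simp only [Sigma.mk.injEq, heq_eq_eq, true_and] at h1 h2
    rwa [h1, h2]
  · intro h
    exact ⟨i, x, y, rfl, rfl, h⟩

/-- Inclusion of a summand. -/
def inj {I : Type v} (C : I → CG.{v} ι) (i : I) : Emb (C i) (DU C) where
  f := fun x => ⟨i, x⟩
  inj := fun _ _ h => eq_of_heq (Sigma.mk.inj h).2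
  adj := fun _ _ => DU.adj_mk
  col := fun _ => rfl

theorem inj_apart {I : Type v} (C : I → CG.{v} ι) {i j : I} (h : i ≠ j) :
    Apart (inj C i) (inj C j) :=
  fun _ _ => ⟨fun h' => h (congrArg Sigma.fst h'), fun h' => h (DU.adj_fst h')⟩

theorem apart_of_fst {I : Type v} {C : I → CG.{v} ι} {A B : CG.{v} ι} {e : Emb A (DU C)}
    {g : Emb B (DU C)} (h : ∀ x y, (e.f x).1 ≠ (g.f y).1) : Apart e g :=
  fun x y => ⟨fun h' => h x y (congrArg Sigma.fst h'), fun h' => h x y (DU.adj_fst h')⟩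

/-- Universal property of disjoint unions. -/
def lift {I : Type v} {C : I → CG.{v} ι} {B : CG.{v} ι} (e : ∀ i, Emb (C i) B)
    (h : ∀ i j, i ≠ j → Apart (e i) (e j)) : Emb (DU C) B where
  f := fun a => (e a.1).f a.2
  inj := by
    rintro ⟨i, x⟩ ⟨j, y⟩ hxy
    by_cases hij : i = j
    · subst hij
      have := (e i).inj hxy
      simp only at this
      rw [this]
    · exact absurd hxy (h i j hij x y).1
  adj := by
    rintro ⟨i, x⟩ ⟨j, y⟩
    by_cases hij : i = j
    · subst hij
      rw [DU.adj_mk]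
      exact (e i).adj x y
    · constructor
      · intro h'; exact absurd h' (h i j hij x y).2
      · intro h'; exact absurd (DU.adj_fst h') hij
  col := fun a => (e a.1).col a.2

/-- Restriction of a disjoint union to some indices. -/
theorem DU.restrict {I : Type v} {C : I → CG.{v} ι} (P : I → Prop) {B : CG.{v} ι}
    (e : Emb B (DU C)) (h : ∀ x, P (e.f x).1) :
    Le B (DU (fun i : {i // P i} => C i)) := by
  let k : Emb (DU (fun i : {i // P i} => C i)) (DU C) :=
    lift (fun i => inj C i) (fun _ _ hij => inj_apart C (fun h => hij (Subtype.ext h)))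
  have hk : ∀ x, ∃ y, k.f y = e.f x := fun x => ⟨⟨⟨(e.f x).1, h x⟩, (e.f x).2⟩, rfl⟩
  choose g hg using hk
  refine ⟨⟨g, fun x y hxy => e.inj ?_, fun x y => ?_, fun x => ?_⟩⟩
  · rw [← hg, ← hg, hxy]
  · rw [← k.adj, hg, hg, e.adj]
  · rw [← k.col, hg, e.col]

theorem DU.restrict_le {I : Type v} (C : I → CG.{v} ι) (P : I → Prop) :
    Le (DU (fun i : {i // P i} => C i)) (DU C) :=
  ⟨lift (fun i => inj C i) (fun _ _ hij => inj_apart C (fun h => hij (Subtype.ext h)))⟩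

/-- Connected coloured graphs. -/
def Con (A : CG.{v} ι) : Prop := IsC A.G Set.univ

theorem Con.const {A : CG.{v} ι} (h : Con A) {J : Type*} (p : A.V → J)
    (hp : ∀ x y, A.G.Adj x y → p x = p y) (a b : A.V) : p a = p b := by
  have := h.2 a trivial b trivial
  induction this with
  | refl => rfl
  | tail _ h ih => exact ih.trans (hp _ _ h.1)

/-- A connected graph embeds into a summand. -/
theorem Con.factor {I : Type v} {C : I → CG.{v} ι} {A : CG.{v} ι} (h : Con A)
    (e : Emb A (DU C)) : ∃ i, ∃ g : Emb A (C i), ∀ x, e.f x = (inj C i).f (g.f x) := by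
  obtain ⟨a, _⟩ := h.1
  obtain ⟨i, h1⟩ : ∃ i, ∀ x, (e.f x).1 = i := ⟨(e.f a).1, fun x =>
    h.const (fun x => (e.f x).1) (fun x y hxy => DU.adj_fst ((e.adj x y).2 hxy)) x a⟩
  have h2 : ∀ x, ∃ y, e.f x = (inj C i).f y := by
    intro x
    have := h1 x
    revert this
    generalize e.f x = z
    rintro rfl
    exact ⟨z.2, rfl⟩
  choose g hg using h2
  refine ⟨i, ⟨g, fun x y hxy => e.inj ?_, fun x y => ?_, fun x => ?_⟩, hg⟩
  · rw [hg, hg, hxy]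
  · rw [← (inj C i).adj, ← hg, ← hg, e.adj]
  · rw [← (inj C i).col, ← hg, e.col]

/-- Isomorphisms of disjoint unions of connected graphs match up the summands. -/
theorem DU.iso_match {I J : Type v} {C : I → CG.{v} ι} {D : J → CG.{v} ι}
    (hC : ∀ i, Con (C i)) (hD : ∀ j, Con (D j)) (h : Iso (DU C) (DU D)) :
    ∃ σ : I → J, Function.Injective σ ∧ ∀ i, Iso (C i) (D (σ i)) := by
  obtain ⟨e, he⟩ := h
  obtain ⟨k, _, hke, hek⟩ := e.exists_inv he
  have h1 : ∀ i, ∃ j, ∃ g : Emb (C i) (D j), ∀ x, e.f ⟨i, x⟩ = (inj D j).f (g.f x) :=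
    fun i => (hC i).factor (e.comp (inj C i))
  choose σ g hg using h1
  have h2 : ∀ j, ∃ i, ∃ g : Emb (D j) (C i), ∀ x, k.f ⟨j, x⟩ = (inj C i).f (g.f x) :=
    fun j => (hD j).factor (k.comp (inj D j))
  choose τ g' hg' using h2
  have hτ : ∀ i, τ (σ i) = i := by
    intro i
    obtain ⟨x, _⟩ := (hC i).1
    have := hke ⟨i, x⟩
    rw [hg] at this
    have h3 := (hg' (σ i) ((g i).f x)).symm.trans this
    exact congrArg Sigma.fst h3
  have hσ : Function.Injective σ := fun i j h => by rw [← hτ i, ← hτ j, h]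
  refine ⟨σ, hσ, fun i => ⟨g i, fun y => ?_⟩⟩
  obtain ⟨⟨i', x⟩, hx⟩ := he ⟨σ i, y⟩
  rw [hg] at hx
  obtain rfl : i' = i := hσ (congrArg Sigma.fst hx)
  exact ⟨x, (inj D _).inj hx⟩

theorem DU.iso_of_equiv {I J : Type v} {C : I → CG.{v} ι} {D : J → CG.{v} ι}
    (σ : I ≃ J) (h : ∀ i, Iso (C i) (D (σ i))) : Iso (DU C) (DU D) := by
  choose e he using h
  refine ⟨lift (fun i => (inj D (σ i)).comp (e i)) fun i j hij =>
    apart_of_fst (fun _ _ h => hij (σ.injective h)), ?_⟩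
  rintro ⟨j, y⟩
  obtain ⟨i, rfl⟩ := σ.surjective j
  obtain ⟨x, rfl⟩ := he i y
  exact ⟨⟨i, x⟩, rfl⟩

theorem DU.le_of_le {I : Type v} {C D : I → CG.{v} ι} (h : ∀ i, Le (C i) (D i)) :
    Le (DU C) (DU D) := by
  have e : ∀ i, Emb (C i) (D i) := fun i => (h i).some
  exact ⟨lift (fun i => (inj D i).comp (e i)) fun i j hij =>
    apart_of_fst (fun _ _ h => hij h)⟩

/-- Induced coloured subgraph. -/
def CG.ind (A : CG.{v} ι) (P : A.V → Prop) : CG.{v} ι where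
  V := {x // P x}
  G := A.G.comap Subtype.val
  c := fun x => A.c x.1

/-- The inclusion. -/
def CG.indEmb (A : CG.{v} ι) (P : A.V → Prop) : Emb (A.ind P) A :=
  ⟨Subtype.val, Subtype.val_injective, fun _ _ => Iff.rfl, fun _ => rfl⟩

/-- Every graph is the disjoint union of connected graphs. -/
theorem exists_components (A : CG.{v} ι) :
    ∃ (I : Type v) (C : I → CG.{v} ι), (∀ i, Con (C i)) ∧ Iso (DU C) A := by
  classical
  let I := A.G.ConnectedComponent
  let C : I → CG.{v} ι := fun i => A.ind (fun x => A.G.connectedComponentMk x = i)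
  refine ⟨I, C, ?_, ?_⟩
  · intro i
    constructor
    · obtain ⟨x, hx⟩ := i.exists_rep
      exact ⟨⟨x, hx⟩, trivial⟩
    · rintro ⟨a, ha⟩ - ⟨b, hb⟩ -
      obtain ⟨w⟩ := SimpleGraph.ConnectedComponent.exact (ha.trans hb.symm)
      induction w with
      | nil => exact Relation.ReflTransGen.refl
      | @cons a c b hac w ih =>
        have hc : A.G.connectedComponentMk c = i :=
          (SimpleGraph.ConnectedComponent.sound hac.reachable).symm.trans ha
        have hac' : (C i).G.Adj ⟨a, ha⟩ ⟨c, hc⟩ := hac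
        exact Relation.ReflTransGen.head ⟨hac', trivial, trivial⟩ (ih hc hb)
  · refine ⟨lift (fun i => A.indEmb _) ?_, fun x => ⟨⟨A.G.connectedComponentMk x, x, rfl⟩, rfl⟩⟩
    rintro i j hij ⟨x, hx⟩ ⟨y, hy⟩
    refine ⟨fun h => hij ?_, fun h => hij ?_⟩
    · have h : x = y := h
      rw [← hx, ← hy, h]
    · have h : A.G.Adj x y := h
      rw [← hx, ← hy]
      exact SimpleGraph.ConnectedComponent.sound h.reachable

theorem Emb.rch {A B : CG.{v} ι} (e : Emb A B) {a b : A.V} (h : Rch A.G Set.univ a b) :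
    Rch B.G Set.univ (e.f a) (e.f b) := by
  induction h with
  | refl => exact Relation.ReflTransGen.refl
  | tail _ h ih => exact Relation.ReflTransGen.tail ih ⟨(e.adj _ _).2 h.1, trivial, trivial⟩

/-- Every component contains a vertex with a colour in `L`. -/
def Live (L : ι → Prop) (A : CG.{v} ι) : Prop := ∀ x, ∃ y, L (A.c y) ∧ Rch A.G Set.univ x y

theorem Live.congr {L : ι → Prop} {A B : CG.{v} ι} (h : Iso A B) (hA : Live L A) : Live L B := by
  obtain ⟨e, he⟩ := h
  intro x
  obtain ⟨x, rfl⟩ := he x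
  obtain ⟨y, hy, hr⟩ := hA x
  exact ⟨e.f y, by rwa [e.col], e.rch hr⟩

theorem live_DU {L : ι → Prop} {I : Type v} {C : I → CG.{v} ι} (hC : ∀ i, Con (C i))
    (h : ∀ i, ∃ y, L ((C i).c y)) : Live L (DU C) := by
  rintro ⟨i, x⟩
  obtain ⟨y, hy⟩ := h i
  exact ⟨⟨i, y⟩, hy, (inj C i).rch ((hC i).2 x trivial y trivial)⟩

theorem Live.DU {L : ι → Prop} {I : Type v} {C : I → CG.{v} ι} (hC : ∀ i, Con (C i))
    (h : Live L (DU C)) (i : I) : ∃ y, L ((C i).c y) := by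
  obtain ⟨x, _⟩ := (hC i).1
  obtain ⟨y, hy, hr⟩ := h ⟨i, x⟩
  have key : ∀ z : (RT.DU C).V, Rch (RT.DU C).G Set.univ ⟨i, x⟩ z → i = z.1 := by
    intro z hz
    induction hz with
    | refl => rfl
    | tail _ h ih => exact ih.trans (DU.adj_fst h.1)
  obtain ⟨j, y⟩ := y
  obtain rfl : i = j := key _ hr
  exact ⟨y, hy⟩

/-- Adding `M` further copies of `X` does not enlarge the disjoint union. -/
def Abs {K : Type v} (Z : K → CG.{v} ι) (X : CG.{v} ι) (M : Type v) : Prop :=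
  Le (DU (Sum.elim Z (fun _ : M => X))) (DU Z)

theorem Abs.mono {K : Type v} {Z : K → CG.{v} ι} {X : CG.{v} ι} {M N : Type v} (φ : N → M)
    (hφ : Function.Injective φ) (h : Abs Z X M) : Abs Z X N := by
  refine Le.trans ⟨lift (fun k => ?_) ?_⟩ h
  · exact match k with
      | Sum.inl i => inj (Sum.elim Z (fun _ : M => X)) (Sum.inl i)
      | Sum.inr m => inj (Sum.elim Z (fun _ : M => X)) (Sum.inr (φ m))
  · rintro (i | m) (j | n) hij
    · exact inj_apart _ (fun h => hij (by rw [Sum.inl.inj h]))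
    · exact inj_apart _ (fun h => nomatch h)
    · exact inj_apart _ (fun h => nomatch h)
    · exact inj_apart _ (fun h => hij (by rw [hφ (Sum.inr.inj h)]))

theorem le_sum {K : Type v} (Z : K → CG.{v} ι) (X : CG.{v} ι) (M : Type v) :
    ∃ w : Emb (DU Z) (DU (Sum.elim Z (fun _ : M => X))), ∀ a, ∃ i, (w.f a).1 = Sum.inl i :=
  ⟨lift (fun i => inj (Sum.elim Z (fun _ : M => X)) (Sum.inl i))
    (fun _ _ hij => inj_apart _ (fun h => hij (Sum.inl.inj h))), fun a => ⟨a.1, rfl⟩⟩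

theorem Abs.sum {K : Type v} {Z : K → CG.{v} ι} {X : CG.{v} ι} {M N : Type v}
    (h : Abs Z X M) (h' : Abs Z X N) : Abs Z X (M ⊕ N) := by
  obtain ⟨e⟩ := h
  obtain ⟨e'⟩ := h'
  obtain ⟨w, hw⟩ := le_sum Z X N
  have key : ∀ (A : CG.{v} ι) (a : Emb A (DU Z)) (n : N),
      Apart (w.comp a) (inj (Sum.elim Z (fun _ : N => X)) (Sum.inr n)) := by
    intro A a n
    refine apart_of_fst fun x y hxy => ?_
    obtain ⟨i, hi⟩ := hw (a.f x)
    exact nomatch hi.symm.trans hxy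
  refine ⟨lift (fun k => ?_) ?_⟩
  · exact match k with
      | Sum.inl i => (e'.comp w).comp (e.comp (inj (Sum.elim Z (fun _ : M => X)) (Sum.inl i)))
      | Sum.inr (Sum.inl m) =>
        (e'.comp w).comp (e.comp (inj (Sum.elim Z (fun _ : M => X)) (Sum.inr m)))
      | Sum.inr (Sum.inr n) => e'.comp (inj (Sum.elim Z (fun _ : N => X)) (Sum.inr n))
  · have h1 : ∀ k k', k ≠ k' → Apart
        ((e'.comp w).comp (e.comp (inj (Sum.elim Z (fun _ : M => X)) k)))
        ((e'.comp w).comp (e.comp (inj (Sum.elim Z (fun _ : M => X)) k'))) :=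
      fun k k' hk => (inj_apart _ hk).comp ((e'.comp w).comp e) (Emb.id _) (Emb.id _)
    have h2 : ∀ k n, Apart
        ((e'.comp w).comp (e.comp (inj (Sum.elim Z (fun _ : M => X)) k)))
        (e'.comp (inj (Sum.elim Z (fun _ : N => X)) (Sum.inr n))) :=
      fun k n => (key _ (e.comp (inj _ k)) n).comp e' (Emb.id _) (Emb.id _)
    rintro (i | m | n) (i' | m' | n') hij
    · exact h1 _ _ (fun h => hij (by rw [Sum.inl.inj h]))
    · exact h1 (Sum.inl i) (Sum.inr m') (fun h => nomatch h)
    · exact h2 (Sum.inl i) n'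
    · exact h1 (Sum.inr m) (Sum.inl i') (fun h => nomatch h)
    · exact h1 (Sum.inr m) (Sum.inr m') (fun h => hij (by rw [Sum.inr.inj h]))
    · exact h2 (Sum.inr m) n'
    · exact (h2 (Sum.inl i') n).symm
    · exact (h2 (Sum.inr m') n).symm
    · exact (inj_apart (Sum.elim Z (fun _ : N => X)) (i := Sum.inr n) (j := Sum.inr n')
        (fun h => hij (by rw [Sum.inr.inj h]))).comp e' (Emb.id _) (Emb.id _)

theorem Abs.finite {K : Type v} {Z : K → CG.{v} ι} {X : CG.{v} ι} {M : Type v} [Nonempty M]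
    (h : Abs Z X M) (N : Type v) [Finite N] : Abs Z X N := by
  classical
  obtain ⟨m⟩ := ‹Nonempty M›
  induction N using Finite.induction_empty_option with
  | of_equiv e ih => exact ih.mono e.symm e.symm.injective
  | h_empty =>
    exact h.mono (fun x : PEmpty => x.elim) (fun x => x.elim)
  | @h_option N _ ih =>
    refine (ih.sum h).mono (fun o => o.elim (Sum.inr m) Sum.inl) ?_
    rintro (_ | a) (_ | b) hab
    · rfl
    · exact nomatch hab
    · exact nomatch hab
    · rw [Sum.inl.inj hab]

theorem union_core (L : ι → Prop) {I J : Type v} {C : I → CG.{v} ι} {D : J → CG.{v} ι}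
    (hC : ∀ i, Con (C i)) (hD : ∀ j, Con (D j)) (hu : ∀ i, Uniq Con (C i))
    (hL : ∀ i, ∃ y, L ((C i).c y))
    (hn : ∀ i, ∀ e e' : Emb (C i) (C i), ¬ Apart e e')
    (g : Emb (DU C) (DU D)) (h : Emb (DU D) (DU C)) (i₀ : I)
    (hT : ¬ Nonempty ({i // Iso (C i) (C i₀)} ↪ {j // Iso (D j) (C i₀)})) : Inf (Live L) (DU C) := by
  classical
  set X := C i₀ with hX
  let T := {i // Iso (C i) X}
  let Z : {i // ¬ Iso (C i) X} → CG.{v} ι := fun i => C i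
  have h1 : ∀ i, ∃ j, ∃ k : Emb (C i) (D j), ∀ x, g.f ⟨i, x⟩ = (inj D j).f (k.f x) :=
    fun i => (hC i).factor (g.comp (inj C i))
  choose π k hk using h1
  -- those that stay at the same level
  let T1 : Set T := {t | Le (D (π t.1)) X}
  have hT1iso : ∀ t ∈ T1, Iso (D (π t.1)) X := by
    intro t ht
    exact (hu i₀ _ (hD _) ⟨t.2.symm.le.trans ⟨k t.1⟩, ht⟩).symm
  have hT1inj : Function.Injective (fun t : T1 => (⟨π t.1.1, hT1iso t.1 t.2⟩ : {j // Iso (D j) X})) := by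
    rintro ⟨t, ht⟩ ⟨t', ht'⟩ htt
    by_contra hne
    have hne' : t.1 ≠ t'.1 := fun h => hne (Subtype.ext (Subtype.ext h))
    have hππ : π t.1 = π t'.1 := congrArg Subtype.val htt
    obtain ⟨d, _⟩ := hT1iso t' ht'
    obtain ⟨a, _⟩ := t.2.symm
    obtain ⟨b, _⟩ := t'.2.symm
    have hap : Apart (g.comp ((inj C t.1).comp a)) (g.comp ((inj C t'.1).comp b)) :=
      (inj_apart C hne').comp g a b
    have hk1 := hk t.1
    have hk2 := hk t'.1
    revert hk1 hk2
    generalize k t.1 = k1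
    generalize k t'.1 = k2
    intro hk1 hk2
    revert k1
    rw [hππ]
    intro k1 hk1
    refine hn i₀ (d.comp (k1.comp a)) (d.comp (k2.comp b)) fun x y => ?_
    have hxy := hap x y
    have e1 : (g.comp ((inj C t.1).comp a)).f x = (inj D (π t'.1)).f (k1.f (a.f x)) := hk1 _
    have e2 : (g.comp ((inj C t'.1).comp b)).f y = (inj D (π t'.1)).f (k2.f (b.f y)) := hk2 _
    rw [e1, e2] at hxy
    refine ⟨fun h => hxy.1 ?_, fun h => hxy.2 ?_⟩
    · have h3 : k1.f (a.f x) = k2.f (b.f y) := d.inj h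
      rw [h3]
    · rw [(inj D _).adj, ← d.adj]; exact h
  have hcard : ¬ Nonempty (T ↪ T1) := by
    rintro ⟨φ⟩
    exact hT ⟨φ.trans ⟨_, hT1inj⟩⟩
  -- the strictly larger summands
  let U : I → Prop := fun i => Le X (C i) ∧ ¬ Le (C i) X
  have hUT : ∀ i, U i → ¬ Iso (C i) X := fun i hi h => hi.2 h.le
  have h2 : ∀ j, ∃ i, ∃ l : Emb (D j) (C i), ∀ x, h.f ⟨j, x⟩ = (inj C i).f (l.f x) :=
    fun j => (hD j).factor (h.comp (inj D j))
  choose θ l hl using h2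
  let f : Emb (DU C) (DU C) := h.comp g
  have hf : ∀ i x, (f.f ⟨i, x⟩).1 = θ (π i) := by
    intro i x
    show (h.f (g.f ⟨i, x⟩)).1 = θ (π i)
    rw [hk]
    exact congrArg Sigma.fst (hl (π i) ((k i).f x))
  have hle : ∀ i, Le (C i) (C (θ (π i))) := fun i => ⟨(l _).comp (k i)⟩
  have hUU : ∀ i, U i → U (θ (π i)) := fun i hi =>
    ⟨hi.1.trans (hle i), fun h' => hi.2 ((hle i).trans h')⟩
  have hTU : ∀ t : T, t ∉ T1 → U (θ (π t.1)) := fun t ht =>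
    ⟨t.2.symm.le.trans (hle _), fun h' => ht (Le.trans ⟨l _⟩ h')⟩
  have hAbs : Abs Z X ↥(T1ᶜ) := by
    let bi : {i // ¬ Iso (C i) X} ⊕ ↥(T1ᶜ) → I := Sum.elim (fun i => i.1) (fun t => t.1.1)
    have hbi : Function.Injective bi := by
      rintro (i | t) (j | t') hij
      · rw [Subtype.ext (show i.1 = j.1 from hij)]
      · have hij : i.1 = t'.1.1 := hij
        exact absurd (hij ▸ t'.1.2) i.2
      · have hij : t.1.1 = j.1 := hij
        exact absurd (hij ▸ t.1.2) j.2
      · rw [Subtype.ext (Subtype.ext (show t.1.1 = t'.1.1 from hij))]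
    have hex : ∀ k, ∃ e : Emb (Sum.elim Z (fun _ : ↥(T1ᶜ) => X) k) (DU C),
        (U (θ (π (bi k))) ∧ ∃ a : Emb (Sum.elim Z (fun _ : ↥(T1ᶜ) => X) k) (C (bi k)),
          e = f.comp ((inj C (bi k)).comp a)) ∨
        (¬ U (bi k) ∧ ¬ Iso (C (bi k)) X ∧
          ∃ a : Emb (Sum.elim Z (fun _ : ↥(T1ᶜ) => X) k) (C (bi k)),
          e = (inj C (bi k)).comp a) := by
      rintro (i | t)
      · by_cases hi : U i.1
        · exact ⟨f.comp ((inj C i.1).comp (Emb.id _)), Or.inl ⟨hUU _ hi, Emb.id _, rfl⟩⟩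
        · exact ⟨(inj C i.1).comp (Emb.id _), Or.inr ⟨hi, i.2, Emb.id _, rfl⟩⟩
      · obtain ⟨a⟩ := t.1.2.symm.le
        exact ⟨f.comp ((inj C t.1.1).comp a), Or.inl ⟨hTU _ t.2, a, rfl⟩⟩
    choose e he using hex
    have hmix : ∀ (A B : CG.{v} ι) (i j : I) (a : Emb A (C i)) (b : Emb B (C j)),
        U (θ (π i)) → ¬ U j → Apart (f.comp ((inj C i).comp a)) ((inj C j).comp b) := by
      intro A B i j a b hi hj
      refine apart_of_fst fun x y hxy => hj ?_
      have h3 : θ (π i) = j := (hf i (a.f x)).symm.trans hxy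
      exact h3 ▸ hi
    have hap : ∀ k k', k ≠ k' → Apart (e k) (e k') := by
      intro k k' hkk
      have hne : bi k ≠ bi k' := fun h => hkk (hbi h)
      rcases he k with ⟨h1, a, ha⟩ | ⟨h1, h1', a, ha⟩ <;>
      rcases he k' with ⟨h2, b, hb⟩ | ⟨h2, h2', b, hb⟩ <;> rw [ha, hb]
      · exact (inj_apart C hne).comp f a b
      · exact hmix _ _ _ _ a b h1 h2
      · exact (hmix _ _ _ _ b a h2 h1).symm
      · exact (inj_apart C hne).comp (Emb.id _) a b
    refine DU.restrict (fun i => ¬ Iso (C i) X) (lift e hap) ?_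
    rintro ⟨k, x⟩
    show ¬ Iso (C ((e k).f x).1) X
    rcases he k with ⟨h1, a, ha⟩ | ⟨h1, h1', a, ha⟩
    · rw [ha]
      have h3 : ((f.comp ((inj C (bi k)).comp a)).f x).1 = θ (π (bi k)) := hf _ (a.f x)
      rw [h3]
      exact hUT _ h1
    · rw [ha]
      exact h1'
  have hT2 : Nonempty ↥(T1ᶜ) := by
    by_contra hemp
    have hall : ∀ t, t ∈ T1 := fun t => by
      by_contra ht
      exact hemp ⟨⟨t, ht⟩⟩
    exact hcard ⟨⟨fun t => ⟨t, hall t⟩, fun a b hab => congrArg Subtype.val hab⟩⟩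
  have hAbsT : Abs Z X T := by
    rcases finite_or_infinite T with hfin | hinf
    · exact hAbs.finite T
    · have hlt : Cardinal.mk T1 < Cardinal.mk T := by
        by_contra hge
        exact hcard (Cardinal.le_def _ _ |>.1 (not_lt.1 hge))
      have heq := Cardinal.mk_compl_of_infinite T1 hlt
      obtain ⟨φ⟩ := Cardinal.eq.1 heq.symm
      exact hAbs.mono φ φ.injective
  -- the whole graph is small
  have hwhole : Le (DU C) (DU Z) := by
    refine Le.trans ?_ hAbsT
    let κ : I → {i // ¬ Iso (C i) X} ⊕ T := fun i =>
      if h : Iso (C i) X then Sum.inr ⟨i, h⟩ else Sum.inl ⟨i, h⟩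
    have hκ : Function.Injective κ := by
      intro i j hij
      by_cases hi : Iso (C i) X <;> by_cases hj : Iso (C j) X <;>
        simp only [κ, hi, hj, dif_pos, dif_neg, not_false_eq_true] at hij
      · exact congrArg Subtype.val (Sum.inr.inj hij)
      · exact nomatch hij
      · exact nomatch hij
      · exact congrArg Subtype.val (Sum.inl.inj hij)
    have hex : ∀ i, ∃ e : Emb (C i) (DU (Sum.elim Z (fun _ : T => X))),
        ∀ x, (e.f x).1 = κ i := by
      intro i
      by_cases hi : Iso (C i) X
      · obtain ⟨a⟩ := hi.le
        refine ⟨(inj (Sum.elim Z (fun _ : T => X)) (Sum.inr ⟨i, hi⟩)).comp a, fun x => ?_⟩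
        simp only [κ, hi, dif_pos]
        rfl
      · refine ⟨inj (Sum.elim Z (fun _ : T => X)) (Sum.inl ⟨i, hi⟩), fun x => ?_⟩
        simp only [κ, hi, dif_neg, not_false_eq_true]
        rfl
    choose e he using hex
    exact ⟨lift e fun i j hij => apart_of_fst fun x y hxy =>
      hij (hκ ((he i x).symm.trans (hxy.trans (he j y))))⟩
  let F : ℕ → CG.{v} ι := fun n => DU (Sum.elim Z (fun _ : ULift.{v} (Fin n) => X))
  have hFcon : ∀ (n : ℕ) k, Con (Sum.elim Z (fun _ : ULift.{v} (Fin n) => X) k) := by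
    rintro n (i | m)
    · exact hC _
    · exact hC _
  have hFle : ∀ n m, Iso (F n) (F m) → n ≤ m := by
    intro n m hnm
    obtain ⟨σ, hσ, hiso⟩ := DU.iso_match (hFcon n) (hFcon m) hnm
    have hr : ∀ a : Fin n, ∃ b : Fin m, σ (Sum.inr ⟨a⟩) = Sum.inr ⟨b⟩ := by
      intro a
      have := hiso (Sum.inr ⟨a⟩)
      revert this
      rcases σ (Sum.inr ⟨a⟩) with i | b
      · intro h3
        exact absurd (Iso.symm h3) i.2
      · exact fun _ => ⟨b.down, rfl⟩
    choose τ hτ using hr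
    have hτi : Function.Injective τ := by
      intro a b hab
      have h3 := hτ a
      rw [hab, ← hτ b] at h3
      have := hσ h3
      exact congrArg ULift.down (Sum.inr.inj this)
    simpa using Fintype.card_le_of_injective τ hτi
  refine ⟨F, fun n m hnm hiso => hnm (le_antisymm (hFle _ _ hiso) (hFle _ _ hiso.symm)),
    fun n => ⟨?_, ?_, ?_⟩⟩
  · refine live_DU (hFcon n) ?_
    rintro (i | m)
    · exact hL _
    · exact hL _
  · obtain ⟨w, _⟩ := le_sum Z X (ULift.{v} (Fin n))
    exact hwhole.trans ⟨w⟩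
  · exact Le.trans (hAbs.finite (ULift.{v} (Fin n))) (DU.restrict_le C _)

theorem exists_equiv {I J : Type v} {C : I → CG.{v} ι} {D : J → CG.{v} ι}
    (h : ∀ i₀, Nonempty ({i // Iso (C i) (C i₀)} ↪ {j // Iso (D j) (C i₀)}))
    (h' : ∀ j₀, Nonempty ({j // Iso (D j) (D j₀)} ↪ {i // Iso (C i) (D j₀)})) :
    Iso (DU C) (DU D) := by
  classical
  have gen : ∀ {I J : Type v} {C : I → CG.{v} ι} {D : J → CG.{v} ι}
      (_ : ∀ i₀, Nonempty ({i // Iso (C i) (C i₀)} ↪ {j // Iso (D j) (C i₀)})) (X : CG.{v} ι),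
      Nonempty ({i // Iso (C i) X} ↪ {j // Iso (D j) X}) := by
    intro I J C D h X
    by_cases hne : ∃ i₀, Iso (C i₀) X
    · obtain ⟨i₀, hi⟩ := hne
      have e1 : ∀ A : CG.{v} ι, Iso A (C i₀) ↔ Iso A X := fun A =>
        ⟨fun h => h.trans hi, fun h => h.trans hi.symm⟩
      have := h i₀
      simpa only [e1] using this
    · exact ⟨⟨fun i => absurd ⟨i.1, i.2⟩ hne, fun i => absurd ⟨i.1, i.2⟩ hne⟩⟩
  let sd : Setoid (CG.{v} ι) := ⟨Iso, Iso.refl, Iso.symm, Iso.trans⟩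
  let p : I → Quotient sd := fun i => Quotient.mk sd (C i)
  let q : J → Quotient sd := fun j => Quotient.mk sd (D j)
  have hfib : ∀ y : Quotient sd, Nonempty ({i // p i = y} ≃ {j // q j = y}) := by
    intro y
    obtain ⟨X, rfl⟩ := Quotient.exists_rep y
    have e1 : ∀ A : CG.{v} ι, Quotient.mk sd A = Quotient.mk sd X ↔ Iso A X :=
      fun A => Quotient.eq (r := sd)
    obtain ⟨a⟩ := gen h X
    obtain ⟨b⟩ := gen h' X
    obtain ⟨c⟩ := Function.Embedding.antisymm a b
    simp only [p, q, e1]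
    exact ⟨c⟩
  have e := fun y => (hfib y).some
  let σ : I ≃ J := (Equiv.sigmaFiberEquiv p).symm.trans
    ((Equiv.sigmaCongrRight e).trans (Equiv.sigmaFiberEquiv q))
  refine DU.iso_of_equiv σ fun i => ?_
  have : q (σ i) = p i := (e (p i) ⟨i, rfl⟩).2
  exact (Quotient.exact this.symm : sd.r _ _)

theorem union_inf (L : ι → Prop) {I : Type v} (C : I → CG.{v} ι) (hC : ∀ i, Con (C i))
    (hL : ∀ i, ∃ y, L ((C i).c y)) (h : ∃ i, Inf Con (C i)) : Inf (Live L) (DU C) := by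
  classical
  obtain ⟨i₀, F, hF1, hF2⟩ := h
  let C' : ℕ → I → CG.{v} ι := fun n i => if Eqm (C i) (C i₀) then F n else C i
  have hC' : ∀ n i, Eqm (C i) (C' n i) ∧ Con (C' n i) := by
    intro n i
    by_cases h : Eqm (C i) (C i₀)
    · simp only [C', h, if_true]; exact ⟨h.trans (hF2 n).2, (hF2 n).1⟩
    · simp only [C', h, if_false]; exact ⟨Eqm.refl _, hC i⟩
  refine ⟨fun n => DU (C' n), fun n m hnm hiso => ?_, fun n => ⟨?_, ?_, ?_⟩⟩
  · obtain ⟨σ, _, hσ⟩ := DU.iso_match (fun i => (hC' n i).2) (fun i => (hC' m i).2) hiso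
    have h0 := hσ i₀
    simp only [C', Eqm.refl, if_true] at h0
    by_cases h : Eqm (C (σ i₀)) (C i₀)
    · simp only [h, if_true] at h0
      exact hF1 n m hnm h0
    · simp only [h, if_false] at h0
      exact h (h0.symm.eqm.trans (hF2 n).2.symm)
  · refine live_DU (fun i => (hC' n i).2) fun i => ?_
    obtain ⟨e⟩ := (hC' n i).1.1
    obtain ⟨y, hy⟩ := hL i
    exact ⟨e.f y, by rwa [e.col]⟩
  · exact DU.le_of_le fun i => (hC' n i).1.1
  · exact DU.le_of_le fun i => (hC' n i).1.2

/-- The union lemma. -/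
theorem union_alt (L : ι → Prop) (A : CG.{v} ι) (hLA : Live L A)
    (hA : ∀ X, Con X → Le X A → Alt Con X)
    (hn : ∀ X, Con X → Le X A → ∀ e e' : Emb X X, ¬ Apart e e') : Alt (Live L) A := by
  classical
  obtain ⟨I, C, hC, hiso⟩ := exists_components A
  refine Alt.congr hiso ?_
  by_contra hcon
  have h1 : ¬ Uniq (Live L) (DU C) := fun h => hcon (Or.inl h)
  have h2 : ¬ Inf (Live L) (DU C) := fun h => hcon (Or.inr h)
  unfold Uniq at h1
  push Not at h1
  obtain ⟨B, hLB, hBe, hBn⟩ := h1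
  obtain ⟨J, D, hD, hisoB⟩ := exists_components B
  have hCD : Eqm (DU C) (DU D) := hBe.trans hisoB.symm.eqm
  have h2' : ¬ Inf (Live L) (DU D) := fun h => h2 (h.congr hCD.symm)
  have hLC : ∀ i, ∃ y, L ((C i).c y) := (hLA.congr hiso.symm).DU hC
  have hLD : ∀ i, ∃ y, L ((D i).c y) := (hLB.congr hisoB.symm).DU hD
  have hCle : ∀ i, Le (C i) A := fun i => Le.trans ⟨inj C i⟩ hiso.le
  have hDle : ∀ i, Le (D i) A := fun i => (Le.trans ⟨inj D i⟩ hCD.2).trans hiso.le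
  have huC : ∀ i, Uniq Con (C i) := fun i =>
    (hA _ (hC i) (hCle i)).resolve_right fun h => h2 (union_inf L C hC hLC ⟨i, h⟩)
  have huD : ∀ i, Uniq Con (D i) := fun i =>
    (hA _ (hD i) (hDle i)).resolve_right fun h => h2' (union_inf L D hD hLD ⟨i, h⟩)
  obtain ⟨g⟩ := hCD.1
  obtain ⟨h⟩ := hCD.2
  refine hBn ((exists_equiv (C := C) (D := D) ?_ ?_).trans hisoB)
  · intro i
    by_contra hT
    exact h2 (union_core L hC hD huC hLC (fun i => hn _ (hC i) (hCle i)) g h i hT)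
  · intro i
    by_contra hT
    exact h2' (union_core L hD hC huD hLD (fun i => hn _ (hD i) (hDle i)) h g i hT)

/-- The graph outside finitely many pinned vertices, colours recording adjacency to them. -/
def Pin (B : CG.{v} ι) {n : ℕ} (b : Fin n → B.V) : CG.{v} (ι × Set (Fin n)) where
  V := {x // ∀ k, b k ≠ x}
  G := B.G.comap Subtype.val
  c := fun x => (B.c x.1, {k | B.G.Adj (b k) x.1})

/-- Adding the pinned vertices back. -/
def Reb (A : CG.{v} ι) {n : ℕ} (a : Fin n → A.V) (Q : CG.{v} (ι × Set (Fin n))) : CG.{v} ι where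
  V := Fin n ⊕ Q.V
  G :=
    { Adj := fun x y =>
        match x, y with
        | Sum.inl k, Sum.inl l => A.G.Adj (a k) (a l)
        | Sum.inl k, Sum.inr y => k ∈ (Q.c y).2
        | Sum.inr x, Sum.inl l => l ∈ (Q.c x).2
        | Sum.inr x, Sum.inr y => Q.G.Adj x y
      symm := by
        constructor
        rintro (k | x) (l | y) h
        · exact (show A.G.Adj (a k) (a l) from h).symm
        · exact h
        · exact h
        · exact (show Q.G.Adj x y from h).symm
      loopless := by
        constructor
        rintro (k | x) h
        · exact A.G.irrefl h
        · exact Q.G.irrefl h }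
  c := fun x => match x with
    | Sum.inl k => A.c (a k)
    | Sum.inr x => (Q.c x).1

section Pinning

variable {n : ℕ} {A : CG.{v} ι} {a : Fin n → A.V}

theorem Reb.map {Q Q' : CG.{v} (ι × Set (Fin n))} (e : Emb Q Q') :
    ∃ r : Emb (Reb A a Q) (Reb A a Q'), (∀ k, r.f (Sum.inl k) = Sum.inl k) ∧
      (Function.Surjective e.f → Function.Surjective r.f) := by
  refine ⟨⟨Sum.map (fun k => k) e.f, ?_, ?_, ?_⟩, fun k => rfl, ?_⟩
  · exact Function.Injective.sumMap (fun _ _ h => h) e.inj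
  · rintro (k | x) (l | y)
    · exact Iff.rfl
    · show k ∈ (Q'.c (e.f y)).2 ↔ k ∈ (Q.c y).2
      rw [e.col]
    · show l ∈ (Q'.c (e.f x)).2 ↔ l ∈ (Q.c x).2
      rw [e.col]
    · exact e.adj x y
  · rintro (k | x)
    · rfl
    · show (Q'.c (e.f x)).1 = (Q.c x).1
      rw [e.col]
  · rintro h (k | y)
    · exact ⟨Sum.inl k, rfl⟩
    · obtain ⟨x, rfl⟩ := h y
      exact ⟨Sum.inr x, rfl⟩

theorem Reb.iso (ha : Function.Injective a) {B : CG.{v} ι} (g : Emb A B) {b : Fin n → B.V}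
    (hb : ∀ k, g.f (a k) = b k) :
    ∃ r : Emb (Reb A a (Pin B b)) B, (∀ k, r.f (Sum.inl k) = b k) ∧ Function.Surjective r.f := by
  have hbi : Function.Injective b := fun k l h => ha (g.inj (by rw [hb, hb, h]))
  refine ⟨⟨Sum.elim b Subtype.val, ?_, ?_, ?_⟩, fun k => rfl, ?_⟩
  · rintro (k | x) (l | y) h
    · rw [hbi h]
    · exact absurd h (y.2 k)
    · exact absurd h.symm (x.2 l)
    · rw [Subtype.ext h]
  · rintro (k | x) (l | y)
    · show B.G.Adj (b k) (b l) ↔ A.G.Adj (a k) (a l)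
      rw [← hb, ← hb, g.adj]
    · exact Iff.rfl
    · exact B.G.adj_comm _ _
    · exact Iff.rfl
  · rintro (k | x)
    · show B.c (b k) = A.c (a k)
      rw [← hb, g.col]
    · rfl
  · intro x
    by_cases h : ∃ k, b k = x
    · obtain ⟨k, rfl⟩ := h
      exact ⟨Sum.inl k, rfl⟩
    · exact ⟨Sum.inr ⟨x, fun k hk => h ⟨k, hk⟩⟩, rfl⟩

theorem Pin.map {B B' : CG.{v} ι} {b : Fin n → B.V} {b' : Fin n → B'.V} (e : Emb B B')
    (h : ∀ k, e.f (b k) = b' k) : Le (Pin B b) (Pin B' b') := by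
  refine ⟨⟨fun x => ⟨e.f x.1, fun k hk => x.2 k (e.inj ((h k).trans hk))⟩, ?_, ?_, ?_⟩⟩
  · intro x y hxy
    exact Subtype.ext (e.inj (congrArg Subtype.val hxy))
  · intro x y
    exact e.adj x.1 y.1
  · intro x
    refine Prod.ext (e.col x.1) ?_
    ext k
    show B'.G.Adj (b' k) (e.f x.1) ↔ B.G.Adj (b k) x.1
    rw [← h, e.adj]

theorem Reb.inv {Q Q' : CG.{v} (ι × Set (Fin n))} (r : Emb (Reb A a Q) (Reb A a Q'))
    (hr : ∀ k, r.f (Sum.inl k) = Sum.inl k) (hs : Function.Surjective r.f) : Iso Q Q' := by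
  have h1 : ∀ x, ∃ y, r.f (Sum.inr x) = Sum.inr y := by
    intro x
    rcases h : r.f (Sum.inr x) with k | y
    · exact nomatch r.inj (h.trans (hr k).symm)
    · exact ⟨y, rfl⟩
  choose e he using h1
  refine ⟨⟨e, ?_, ?_, ?_⟩, ?_⟩
  · intro x y h
    have : r.f (Sum.inr x) = r.f (Sum.inr y) := by rw [he, he, h]
    exact Sum.inr.inj (r.inj this)
  · intro x y
    have := r.adj (Sum.inr x) (Sum.inr y)
    rw [he, he] at this
    exact this
  · intro x
    refine Prod.ext ?_ ?_
    · have := r.col (Sum.inr x)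
      rw [he] at this
      exact this
    · ext k
      have := r.adj (Sum.inl k) (Sum.inr x)
      rw [he, hr] at this
      exact this
  · intro y
    obtain ⟨x, hx⟩ := hs (Sum.inr y)
    rcases x with k | x
    · rw [hr] at hx
      exact nomatch hx
    · rw [he] at hx
      exact ⟨x, Sum.inr.inj hx⟩

theorem live_pin {B : CG.{v} ι} (hB : Con B) {b : Fin n → B.V} (k₀ : Fin n) :
    Live (fun p => p.2.Nonempty) (Pin B b) := by
  rintro ⟨x, hx⟩
  have key : ∀ z, Rch B.G Set.univ x z →
      (∃ hz : ∀ k, b k ≠ z, Rch (Pin B b).G Set.univ ⟨x, hx⟩ ⟨z, hz⟩) ∨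
      ∃ y, ((Pin B b).c y).2.Nonempty ∧ Rch (Pin B b).G Set.univ ⟨x, hx⟩ y := by
    intro z hz
    induction hz with
    | refl => exact Or.inl ⟨hx, Relation.ReflTransGen.refl⟩
    | @tail z w _ h ih =>
      rcases ih with ⟨hz, hr⟩ | ih
      · by_cases hw : ∃ k, b k = w
        · obtain ⟨k, rfl⟩ := hw
          exact Or.inr ⟨⟨z, hz⟩, ⟨k, h.1.symm⟩, hr⟩
        · have hw' : ∀ k, b k ≠ w := fun k hk => hw ⟨k, hk⟩
          have hadj : (Pin B b).G.Adj ⟨z, hz⟩ ⟨w, hw'⟩ := h.1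
          exact Or.inl ⟨hw', Relation.ReflTransGen.tail hr ⟨hadj, trivial, trivial⟩⟩
      · exact Or.inr ih
  rcases key (b k₀) (hB.2 x trivial _ trivial) with ⟨hz, _⟩ | h
  · exact absurd rfl (hz k₀)
  · exact h

theorem con_reb (hA : Con A) {Q : CG.{v} (ι × Set (Fin n))} (k₀ : Fin n)
    (u : Emb A (Reb A a Q)) (hu : ∀ k, u.f (a k) = Sum.inl k)
    (hQ : Live (fun p => p.2.Nonempty) Q) : Con (Reb A a Q) := by
  have h1 : ∀ k, Rch (Reb A a Q).G Set.univ (Sum.inl k) (Sum.inl k₀) := by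
    intro k
    rw [← hu, ← hu]
    exact u.rch (hA.2 _ trivial _ trivial)
  have h2 : ∀ x, Rch (Reb A a Q).G Set.univ x (Sum.inl k₀) := by
    rintro (k | x)
    · exact h1 k
    · obtain ⟨y, ⟨k, hk⟩, hr⟩ := hQ x
      have h3 : Rch (Reb A a Q).G Set.univ (Sum.inr x) (Sum.inr y) := by
        clear hk
        induction hr with
        | refl => exact Relation.ReflTransGen.refl
        | @tail y z _ h ih =>
          have hadj : (Reb A a Q).G.Adj (Sum.inr y) (Sum.inr z) := h.1
          exact Relation.ReflTransGen.tail ih ⟨hadj, trivial, trivial⟩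
      have hadj : (Reb A a Q).G.Adj (Sum.inr y) (Sum.inl k) := hk
      exact Relation.ReflTransGen.trans
        (Relation.ReflTransGen.tail h3 ⟨hadj, trivial, trivial⟩) (h1 k)
  exact ⟨⟨Sum.inl k₀, trivial⟩, fun x _ y _ => Relation.ReflTransGen.trans (h2 x) (h2 y).symm⟩

/-- Iterates of a self-embedding. -/
def Emb.iter (f : Emb A A) : ℕ → Emb A A
  | 0 => Emb.id A
  | m + 1 => f.comp (Emb.iter f m)

theorem exists_selection (r : Setoid ℕ) (h : ∀ i, {j | r i j}.Finite) :
    ∃ g : ℕ → ℕ, ∀ i j, i ≠ j → ¬ r (g i) (g j) := by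
  classical
  have hinf : Infinite (Quotient r) := by
    by_contra hfin
    rw [not_infinite_iff_finite] at hfin
    have : (Set.univ : Set ℕ) ⊆ ⋃ q : Quotient r, {j | r q.out j} := by
      intro j _
      exact Set.mem_iUnion.2 ⟨Quotient.mk r j, Quotient.mk_out (s := r) j⟩
    exact Set.infinite_univ ((Set.finite_iUnion fun q : Quotient r => h q.out).subset this)
  let φ := Infinite.natEmbedding (Quotient r)
  refine ⟨fun i => (φ i).out, fun i j hij hr => hij (φ.injective ?_)⟩
  rw [← Quotient.out_eq (φ i), ← Quotient.out_eq (φ j)]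
  exact Quotient.sound hr

/-- The pinning lemma. -/
theorem pin_alt (hA : Con A) (ha : Function.Injective a) (k₀ : Fin n)
    (hK : ∀ (f : Emb A A) k, ∃ l, f.f (a k) = a l)
    (hAlt : Alt (Live (fun p => p.2.Nonempty)) (Pin A a)) : Alt Con A := by
  classical
  rcases hAlt with hU | ⟨Q, hQ1, hQ2⟩
  · refine Or.inl fun B hB hAB => ?_
    obtain ⟨g⟩ := hAB.1
    obtain ⟨h⟩ := hAB.2
    choose σ hσ using hK (h.comp g)
    have hσi : Function.Injective σ := fun k l hkl =>
      ha ((h.comp g).inj (by rw [hσ, hσ, hkl]))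
    let τ : Equiv.Perm (Fin n) := Equiv.ofBijective σ (Finite.injective_iff_bijective.1 hσi)
    obtain ⟨m, hm⟩ : ∃ m, τ ^ (m + 1) = 1 := by
      refine ⟨Fintype.card (Equiv.Perm (Fin n)) - 1, ?_⟩
      rw [Nat.sub_add_cancel Fintype.card_pos]
      exact pow_card_eq_one
    have hit : ∀ m k, ((h.comp g).iter m).f (a k) = a ((τ ^ m) k) := by
      intro m k
      induction m with
      | zero => rfl
      | succ m ih =>
        show (h.comp g).f (((h.comp g).iter m).f (a k)) = _
        rw [ih, hσ, pow_succ']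
        rfl
    have hback : ∀ k, (((h.comp g).iter m).comp h).f (g.f (a k)) = a k := by
      intro k
      show ((h.comp g).iter m).f ((h.comp g).f (a k)) = a k
      rw [hσ, hit]
      have : (τ ^ m) (σ k) = (τ ^ (m + 1)) k := by rw [pow_succ]; rfl
      rw [this, hm]
      rfl
    have hpe : Eqm (Pin A a) (Pin B (fun k => g.f (a k))) :=
      ⟨Pin.map g (fun _ => rfl), Pin.map _ hback⟩
    obtain ⟨e, he⟩ := hU _ (live_pin hB k₀) hpe
    obtain ⟨r1, _, hr1⟩ := Reb.iso ha (Emb.id A) (b := a) (fun _ => rfl)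
    obtain ⟨r2, _, hr2⟩ := Reb.map (A := A) (a := a) e
    obtain ⟨r3, _, hr3⟩ := Reb.iso ha g (b := fun k => g.f (a k)) (fun _ => rfl)
    exact (Iso.symm ⟨r1, hr1⟩).trans (Iso.trans ⟨r2, hr2 he⟩ ⟨r3, hr3⟩)
  · right
    obtain ⟨r, hr, hrs⟩ := Reb.iso ha (Emb.id A) (b := a) (fun _ => rfl)
    obtain ⟨r', _, hr', _⟩ := r.exists_inv hrs
    have hup : ∀ i, ∃ u : Emb A (Reb A a (Q i)), ∀ k, u.f (a k) = Sum.inl k := by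
      intro i
      obtain ⟨e⟩ := (hQ2 i).2.1
      obtain ⟨s, hs, _⟩ := Reb.map (A := A) (a := a) e
      refine ⟨s.comp r', fun k => ?_⟩
      show s.f (r'.f (a k)) = _
      have h3 : r'.f (a k) = Sum.inl k := (congrArg r'.f (hr k).symm).trans (hr' (Sum.inl k))
      exact (congrArg s.f h3).trans (hs k)
    have hdn : ∀ i, ∃ d : Emb (Reb A a (Q i)) A, ∀ k, d.f (Sum.inl k) = a k := by
      intro i
      obtain ⟨e⟩ := (hQ2 i).2.2
      obtain ⟨s, hs, _⟩ := Reb.map (A := A) (a := a) e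
      refine ⟨r.comp s, fun k => ?_⟩
      show r.f (s.f (Sum.inl k)) = _
      rw [hs, hr]
    choose u hu using hup
    choose d hd using hdn
    have hperm : ∀ i j (φ : Emb (Reb A a (Q i)) (Reb A a (Q j))) k, ∃ l,
        φ.f (Sum.inl k) = Sum.inl l := by
      intro i j φ k
      obtain ⟨l, hl⟩ := hK ((d j).comp (φ.comp (u i))) k
      refine ⟨l, (d j).inj ?_⟩
      rw [hd, ← hl, ← hu i]
      rfl
    let st : Setoid ℕ := ⟨fun i j => Iso (Reb A a (Q i)) (Reb A a (Q j)),
      fun _ => Iso.refl _, Iso.symm, Iso.trans⟩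
    obtain ⟨s, hs⟩ := exists_selection st (by
      intro i
      have hex : ∀ j, ∃ σ : Fin n → Fin n, Iso (Reb A a (Q i)) (Reb A a (Q j)) →
          ∃ φ : Emb (Reb A a (Q i)) (Reb A a (Q j)), Function.Surjective φ.f ∧
            ∀ k, φ.f (Sum.inl k) = Sum.inl (σ k) := by
        intro j
        by_cases h : Iso (Reb A a (Q i)) (Reb A a (Q j))
        · obtain ⟨φ, hφ⟩ := h
          choose σ hσ using hperm i j φ
          exact ⟨σ, fun _ => ⟨φ, hφ, hσ⟩⟩
        · exact ⟨fun k => k, fun h' => absurd h' h⟩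
      choose σ hσ using hex
      refine Set.Finite.of_finite_image (f := σ) (Set.toFinite _) ?_
      intro j hj j' hj' hjj
      obtain ⟨φ, hφ, h1⟩ := hσ j hj
      obtain ⟨ψ, hψ, h2⟩ := hσ j' hj'
      by_contra hne
      refine hQ1 j j' hne ?_
      obtain ⟨φ', hφ', h3, _⟩ := φ.exists_inv hφ
      have hσi : Function.Injective (σ j) := fun k l hkl => by
        have : φ.f (Sum.inl k) = φ.f (Sum.inl l) := by rw [h1, h1, hkl]
        exact Sum.inl.inj (φ.inj this)
      refine Reb.inv (ψ.comp φ') (fun k => ?_) (hψ.comp hφ')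
      obtain ⟨l, rfl⟩ := Finite.surjective_of_injective hσi k
      show ψ.f (φ'.f (Sum.inl (σ j l))) = _
      have h4 : φ'.f (Sum.inl (σ j l)) = Sum.inl l :=
        (congrArg φ'.f (h1 l).symm).trans (h3 (Sum.inl l))
      exact (congrArg ψ.f h4).trans ((h2 l).trans (by rw [hjj])))
    exact ⟨fun i => Reb A a (Q (s i)), hs, fun i =>
      ⟨con_reb hA k₀ (u _) (hu _) (hQ2 _).1, ⟨u _⟩, ⟨d _⟩⟩⟩

end Pinning

theorem not_apart_of_rk {X : CG.{v} ι} (hX : Con X) {α : Ordinal.{v}} (h : Rk X.G α Set.univ)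
    (e e' : Emb X X) : ¬ Apart e e' := by
  intro hap
  obtain ⟨x, y, hxy⟩ := no_two h hX e.f e'.f e.inj e'.inj (fun x y => (e.adj x y).2)
    (fun x y => (e'.adj x y).2)
  exact (hap x y).1 hxy

/-- The alternative for connected coloured graphs within connected graphs. -/
theorem main_con (α : Ordinal.{v}) : ∀ (ι : Type) (A : CG.{v} ι), Con A → Rk A.G α Set.univ →
    Alt Con A := by
  classical
  induction α using WellFoundedLT.induction with
  | ind α ih =>
    intro ι A hA hr
    by_cases hβ : ∃ β < α, Rk A.G β Set.univ
    · obtain ⟨β, hβ, hr⟩ := hβ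
      exact ih β hβ ι A hA hr
    obtain ⟨K, hK, hmin⟩ := exists_kernel hr
    have hne : K.Nonempty := by
      by_contra hne
      rw [Set.not_nonempty_iff_eq_empty] at hne
      obtain ⟨γ, h1, h2⟩ := hK.2 Set.univ (by simp [hne]) hA
      exact hβ ⟨γ, h1, h2⟩
    have : Finite K := hK.1
    obtain ⟨n, ⟨φ⟩⟩ := Finite.exists_equiv_fin K
    let a : Fin n → A.V := fun k => (φ.symm k).1
    have ha : Function.Injective a := fun k l h => φ.symm.injective (Subtype.ext h)
    have hmem : ∀ x ∈ K, ∃ k, a k = x := fun x hx => ⟨φ ⟨x, hx⟩, by simp [a]⟩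
    obtain ⟨x₀, hx₀⟩ := hne
    have hrank : ∀ X, Con X → Le X (Pin A a) → ∃ γ < α, Rk X.G γ Set.univ := by
      rintro X hX ⟨e⟩
      let f : X.V → A.V := fun x => (e.f x).1
      have hfi : Function.Injective f := fun x y h => e.inj (Subtype.ext h)
      have hfa : ∀ x y, X.G.Adj x y → A.G.Adj (f x) (f y) := fun x y h => (e.adj x y).2 h
      obtain ⟨γ, hγ, hr⟩ := hK.2 (f '' Set.univ) (by
        rintro _ ⟨x, -, rfl⟩
        refine ⟨trivial, fun hx => ?_⟩
        obtain ⟨k, hk⟩ := hmem _ hx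
        exact (e.f x).2 k hk) (IsC.image f hfa hX)
      exact ⟨γ, hγ, Rk.pull f hfi hfa γ _ _ subset_rfl hr⟩
    refine pin_alt hA ha (φ ⟨x₀, hx₀⟩) ?_ ?_
    · intro f k
      obtain ⟨l, hl⟩ := hmem _ (kernel_self hK hmin f.f f.inj (fun x y => (f.adj x y).2) (a k)
        (φ.symm k).2)
      exact ⟨l, hl.symm⟩
    · refine union_alt _ _ (live_pin hA (φ ⟨x₀, hx₀⟩)) ?_ ?_
      · intro X hX hle
        obtain ⟨γ, hγ, hr⟩ := hrank X hX hle
        exact ih γ hγ _ X hX hr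
      · intro X hX hle
        obtain ⟨γ, hγ, hr⟩ := hrank X hX hle
        exact not_apart_of_rk hX hr

theorem main_alt {α : Ordinal.{v}} (A : CG.{v} ι) (hr : Rk A.G α Set.univ) :
    Alt (Live (fun _ => True)) A := by
  have hrank : ∀ X, Le X A → Rk X.G α Set.univ := by
    rintro X ⟨e⟩
    exact Rk.pull e.f e.inj (fun x y => (e.adj x y).2) α _ _ (Set.subset_univ _) hr
  refine union_alt _ _ (fun x => ⟨x, trivial, Relation.ReflTransGen.refl⟩) ?_ ?_
  · exact fun X hX hle => main_con α ι X hX (hrank X hle)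
  · exact fun X hX hle => not_apart_of_rk hX (hrank X hle)

/-- A plain graph as a coloured graph. -/
def plain {V : Type v} (G : SimpleGraph V) : CG.{v} Unit := ⟨V, G, fun _ => ()⟩

theorem plain_le {A B : CG.{v} Unit} : Le A B ↔ Nonempty (A.G ↪g B.G) := by
  constructor
  · rintro ⟨e⟩
    exact ⟨⟨⟨e.f, e.inj⟩, fun {x y} => e.adj x y⟩⟩
  · rintro ⟨e⟩
    exact ⟨⟨e, e.injective, fun x y => e.map_adj_iff, fun _ => rfl⟩⟩

theorem plain_iso {A B : CG.{v} Unit} : Iso A B ↔ Nonempty (A.G ≃g B.G) := by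
  constructor
  · rintro ⟨e, he⟩
    exact ⟨⟨Equiv.ofBijective e.f ⟨e.inj, he⟩, fun {x y} => e.adj x y⟩⟩
  · rintro ⟨e⟩
    exact ⟨⟨e, e.injective, fun x y => e.map_adj_iff, fun _ => rfl⟩, e.surjective⟩

end RT

/-- A rayless graph has either no strong twin or infinitely many pairwise
non-isomorphic strong twins. -/
theorem rayless_strongTwin_alternative {V : Type u} (G : SimpleGraph V)
    (hG : G.IsRayless) :
    (¬ ∃ (W : Type u) (H : SimpleGraph W), G.StrongTwins H) ∨
    (∃ F : ℕ → Σ W : Type u, SimpleGraph W,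
      (∀ i j, i ≠ j → ¬ Nonempty ((F i).2 ≃g (F j).2)) ∧
      ∀ i, G.StrongTwins (F i).2) := by
  classical
  obtain ⟨α, hα⟩ := RT.exists_rank hG
  rcases RT.main_alt (RT.plain G) hα with hU | ⟨F, hF1, hF2⟩
  · left
    rintro ⟨W, H, hn, h1, h2⟩
    have := hU (RT.plain H) (fun x => ⟨x, trivial, Relation.ReflTransGen.refl⟩)
      ⟨RT.plain_le.2 h1, RT.plain_le.2 h2⟩
    exact hn (RT.plain_iso.1 this)
  · right
    obtain ⟨k, hk⟩ : ∃ k, ∀ i, ¬ RT.Iso (RT.plain G) (F (i + k)) := by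
      by_cases h : ∃ k, RT.Iso (RT.plain G) (F k)
      · obtain ⟨k, hk⟩ := h
        refine ⟨k + 1, fun i hi => ?_⟩
        exact hF1 k (i + (k + 1)) (by omega) (hk.symm.trans hi)
      · exact ⟨0, fun i hi => h ⟨_, hi⟩⟩
    refine ⟨fun i => ⟨(F (i + k)).V, (F (i + k)).G⟩, fun i j hij h => ?_, fun i => ⟨?_, ?_, ?_⟩⟩
    · exact hF1 (i + k) (j + k) (by omega) (RT.plain_iso.2 h)
    · exact fun h => hk i (RT.plain_iso.2 h)
    · exact RT.plain_le.1 (hF2 (i + k)).2.1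
    · exact RT.plain_le.1 (hF2 (i + k)).2.2
end

section
/- Let G be a rayless graph. Then either G has no weak twin, or there exist infinitely many pairwise non-isomorphic graphs each of which is a weak twin of G. -/
/-- Two graphs are weak twins if they are non-isomorphic and there are injective
graph homomorphisms in both directions. -/
def SimpleGraph.WeakTwins {V W : Type*} (G : SimpleGraph V) (H : SimpleGraph W) : Prop :=
  ¬ Nonempty (G ≃g H) ∧ (∃ f : G →g H, Function.Injective f) ∧
    (∃ g : H →g G, Function.Injective g)

universe u
namespace RaylessTwins

open Relation Set

section Rank

variable {V : Type u} {W : Type u}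

/-- adjacency restricted to a set -/
def ROn (r : V → V → Prop) (U : Set V) (a b : V) : Prop := r a b ∧ a ∈ U ∧ b ∈ U

/-- a nonempty set which is connected -/
def ConnOn (r : V → V → Prop) (U : Set V) : Prop :=
  U.Nonempty ∧ ∀ x ∈ U, ∀ y ∈ U, ReflTransGen (ROn r U) x y

inductive Rk (r : V → V → Prop) : Ordinal.{u} → Set V → Prop
  | mk (α : Ordinal.{u}) (U K : Set V) (hK : K.Finite) (b : Set V → Ordinal.{u})
      (hb : ∀ X, X ⊆ U \ K → ConnOn r X → b X < α)
      (h : ∀ X, X ⊆ U \ K → ConnOn r X → Rk r (b X) X) : Rk r α U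

def GoodK (r : V → V → Prop) (α : Ordinal.{u}) (U K : Set V) : Prop :=
  K.Finite ∧ ∀ X, X ⊆ U \ K → ConnOn r X → ∃ β < α, Rk r β X

lemma rk_iff {r : V → V → Prop} {α : Ordinal.{u}} {U : Set V} :
    Rk r α U ↔ ∃ K, GoodK r α U K := by
  constructor
  · rintro ⟨_, _, K, hK, b, hb, h⟩
    exact ⟨K, hK, fun X hX hc => ⟨b X, hb X hX hc, h X hX hc⟩⟩
  · rintro ⟨K, hK, h⟩
    classical
    choose! b hb using h
    exact Rk.mk α U K hK b (fun X hX hc => (hb X hX hc).1) (fun X hX hc => (hb X hX hc).2)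

lemma ConnOn.image {r : V → V → Prop} {s : W → W → Prop} {f : V → W}
    (hf : ∀ x y, r x y → s (f x) (f y)) {U : Set V} (hU : ConnOn r U) : ConnOn s (f '' U) := by
  refine ⟨hU.1.image f, ?_⟩
  rintro _ ⟨x, hx, rfl⟩ _ ⟨y, hy, rfl⟩
  refine (hU.2 x hx y hy).lift f ?_
  rintro a b ⟨h1, h2, h3⟩
  exact ⟨hf _ _ h1, ⟨a, h2, rfl⟩, ⟨b, h3, rfl⟩⟩

lemma rk_comap {r : V → V → Prop} {s : W → W → Prop} {f : V → W} (hinj : Function.Injective f)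
    (hf : ∀ x y, r x y → s (f x) (f y)) (α : Ordinal.{u}) :
    ∀ (U : Set V) (U' : Set W), f '' U ⊆ U' → Rk s α U' → Rk r α U := by
  induction α using WellFoundedLT.induction with
  | ind α ih =>
    intro U U' hU h
    obtain ⟨K, hK, h⟩ := rk_iff.1 h
    refine rk_iff.2 ⟨f ⁻¹' K, hK.preimage hinj.injOn, fun X hX hc => ?_⟩
    obtain ⟨β, hβ, hr⟩ := h (f '' X) (by
      rintro _ ⟨x, hx, rfl⟩
      exact ⟨hU ⟨x, (hX hx).1, rfl⟩, (hX hx).2⟩) (hc.image hf)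
    exact ⟨β, hβ, ih β hβ X _ subset_rfl hr⟩

lemma good_comap {r : V → V → Prop} {s : W → W → Prop} {f : V → W} (hinj : Function.Injective f)
    (hf : ∀ x y, r x y → s (f x) (f y)) {α : Ordinal.{u}} {K : Set W}
    (h : GoodK s α univ K) : GoodK r α univ (f ⁻¹' K) := by
  refine ⟨h.1.preimage hinj.injOn, fun X hX hc => ?_⟩
  obtain ⟨β, hβ, hr⟩ := h.2 (f '' X) (by
    rintro _ ⟨x, hx, rfl⟩
    exact ⟨trivial, (hX hx).2⟩) (hc.image hf)
  exact ⟨β, hβ, rk_comap hinj hf β X _ subset_rfl hr⟩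

lemma rk_mono {r : V → V → Prop} {α : Ordinal.{u}} {U U' : Set V} (h : U ⊆ U')
    (hr : Rk r α U') : Rk r α U :=
  rk_comap (f := id) Function.injective_id (fun _ _ h => h) α U U' (by simpa using h) hr

lemma rk_le {r : V → V → Prop} {α β : Ordinal.{u}} {U : Set V} (h : α ≤ β)
    (hr : Rk r α U) : Rk r β U := by
  obtain ⟨K, hK, hr⟩ := rk_iff.1 hr
  refine rk_iff.2 ⟨K, hK, fun X hX hc => ?_⟩
  obtain ⟨γ, hγ, hr⟩ := hr X hX hc
  exact ⟨γ, hγ.trans_le h, hr⟩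

lemma rk_union_fin {r : V → V → Prop} {α : Ordinal.{u}} {U F : Set V} (hF : F.Finite)
    (hr : Rk r α U) : Rk r α (U ∪ F) := by
  obtain ⟨K, hK, hr⟩ := rk_iff.1 hr
  refine rk_iff.2 ⟨K ∪ F, hK.union hF, fun X hX hc => hr X ?_ hc⟩
  intro x hx
  have := hX hx
  simp only [mem_sdiff, mem_union] at this ⊢
  tauto

lemma reach_closed {s : V → V → Prop} {P : V → Prop} (hP : ∀ a b, P a → s a b → P b)
    {x y : V} (h : ReflTransGen s x y) (hx : P x) : P y := by
  induction h with
  | refl => exact hx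
  | tail _ h ih => exact hP _ _ ih h

lemma rk_union_sep {r : V → V → Prop} (hs : ∀ x y, r x y → r y x) {α : Ordinal.{u}} {U U' : Set V}
    (hd : ∀ x ∈ U, ∀ y ∈ U', ¬ r x y)
    (hr : Rk r α U) (hr' : Rk r α U') : Rk r α (U ∪ U') := by
  obtain ⟨K, hK, hr⟩ := rk_iff.1 hr
  obtain ⟨K', hK', hr'⟩ := rk_iff.1 hr'
  refine rk_iff.2 ⟨K ∪ K', hK.union hK', fun X hX hc => ?_⟩
  obtain ⟨x, hx⟩ := hc.1
  have key : ∀ z ∈ X, z ∈ U ∪ U' ∧ z ∉ K ∧ z ∉ K' := by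
    intro z hz
    have := hX hz
    simp only [mem_sdiff, mem_union] at this ⊢
    tauto
  rcases (key x hx).1 with h | h
  · have : X ⊆ U := fun y hy => reach_closed (P := (· ∈ U)) (by
      rintro a b ha ⟨h1, h2, h3⟩
      exact ((key b h3).1).resolve_right fun hb => hd a ha b hb h1) (hc.2 x hx y hy) h
    exact hr X (fun z hz => ⟨this hz, (key z hz).2.1⟩) hc
  · have : X ⊆ U' := fun y hy => reach_closed (P := (· ∈ U')) (by
      rintro a b ha ⟨h1, h2, h3⟩
      exact ((key b h3).1).resolve_left fun hb => hd b hb a ha (hs _ _ h1)) (hc.2 x hx y hy) h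
    exact hr' X (fun z hz => ⟨this hz, (key z hz).2.2⟩) hc

lemma reach_mono {s s' : V → V → Prop} (h : ∀ a b, s a b → s' a b) {x y : V}
    (hxy : ReflTransGen s x y) : ReflTransGen s' x y := by
  induction hxy with
  | refl => exact .refl
  | tail _ h1 ih => exact ih.tail (h _ _ h1)

lemma reach_symm {s : V → V → Prop} (hs : ∀ x y, s x y → s y x) {x y : V}
    (h : ReflTransGen s x y) : ReflTransGen s y x := by
  induction h with
  | refl => exact .refl
  | tail _ h ih => exact .head (hs _ _ h) ih

lemma rOn_symm {r : V → V → Prop} (hs : ∀ x y, r x y → r y x) {U : Set V} :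
    ∀ x y, ROn r U x y → ROn r U y x := fun _ _ h => ⟨hs _ _ h.1, h.2.2, h.2.1⟩

/-- the component of `t` in `U` -/
def compOf (r : V → V → Prop) (U : Set V) (t : V) : Set V := {x | ReflTransGen (ROn r U) t x}

lemma compOf_subset {r : V → V → Prop} {U : Set V} {t : V} (ht : t ∈ U) : compOf r U t ⊆ U := by
  intro x hx
  exact reach_closed (P := (· ∈ U)) (fun a b _ h => h.2.2) hx ht

lemma compOf_conn {r : V → V → Prop} (hs : ∀ x y, r x y → r y x) {U : Set V} {t : V} :
    ConnOn r (compOf r U t) := by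
  have key : ∀ x, ReflTransGen (ROn r U) t x → ReflTransGen (ROn r (compOf r U t)) t x := by
    intro x hx
    induction hx with
    | refl => exact .refl
    | tail h1 h2 ih => exact ih.tail ⟨h2.1, h1, h1.tail h2⟩
  refine ⟨⟨t, .refl⟩, fun x hx y hy => ?_⟩
  exact (reach_symm (rOn_symm hs) (key x hx)).trans (key y hy)

lemma conn_subset_compOf {r : V → V → Prop} {U X : Set V} {t : V} (hX : ConnOn r X) (h : X ⊆ U)
    (ht : t ∈ X) : X ⊆ compOf r U t := fun x hx =>
  reach_mono (fun _ _ h' => ⟨h'.1, h h'.2.1, h h'.2.2⟩) (hX.2 t ht x hx)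

lemma rk_finite_comps {r : V → V → Prop} (hs : ∀ x y, r x y → r y x) {α : Ordinal.{u}}
    (hα : 0 < α) {U : Set V} (hU : ∀ X ⊆ U, ConnOn r X → ∃ β < α, Rk r β X) {T : Set V}
    (hT : T.Finite) : T ⊆ U → ∃ β < α, Rk r β {x | ∃ t ∈ T, ReflTransGen (ROn r U) t x} := by
  induction T, hT using Set.Finite.induction_on with
  | empty =>
    intro _
    refine ⟨0, hα, rk_iff.2 ⟨∅, finite_empty, ?_⟩⟩
    intro X hX hc
    obtain ⟨x, hx⟩ := hc.1
    obtain ⟨⟨t, ht, _⟩, _⟩ := hX hx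
    exact ht.elim
  | @insert a T ha hT ih =>
    intro hTU
    obtain ⟨β, hβ, hr⟩ := ih (fun x hx => hTU (mem_insert_of_mem _ hx))
    have haU := hTU (mem_insert a T)
    by_cases hm : ∃ t ∈ T, ReflTransGen (ROn r U) t a
    · refine ⟨β, hβ, rk_mono ?_ hr⟩
      rintro x ⟨t, ht, hx⟩
      rcases ht with rfl | ht
      · obtain ⟨s, hs, h⟩ := hm
        exact ⟨s, hs, h.trans hx⟩
      · exact ⟨t, ht, hx⟩
    · obtain ⟨γ, hγ, hr'⟩ := hU _ (compOf_subset haU) (compOf_conn hs)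
      refine ⟨max β γ, max_lt hβ hγ, rk_mono ?_ (rk_union_sep hs ?_
        (rk_le (le_max_left β γ) hr) (rk_le (le_max_right β γ) hr'))⟩
      · rintro x ⟨t, ht, hx⟩
        rcases ht with rfl | ht
        · exact Or.inr hx
        · exact Or.inl ⟨t, ht, hx⟩
      · rintro x ⟨t, ht, hx⟩ y hy hxy
        have hxU : x ∈ U := compOf_subset (hTU (mem_insert_of_mem _ ht)) hx
        have hyU : y ∈ U := compOf_subset haU hy
        exact hm ⟨t, ht, (hx.tail ⟨hxy, hxU, hyU⟩).trans (reach_symm (rOn_symm hs) hy)⟩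

lemma good_inter {r : V → V → Prop} (hs : ∀ x y, r x y → r y x) {α : Ordinal.{u}} {S S' : Set V}
    (h : GoodK r α univ S) (h' : GoodK r α univ S') : GoodK r α univ (S ∩ S') := by
  refine ⟨h.1.inter_of_left _, fun X hX hc => ?_⟩
  by_cases hT : ∃ t ∈ X, t ∈ S
  swap
  · exact h.2 X (fun x hx => ⟨trivial, fun h => hT ⟨x, hx, h⟩⟩) hc
  by_cases hT' : ∃ t ∈ X, t ∈ S'
  swap
  · exact h'.2 X (fun x hx => ⟨trivial, fun h => hT' ⟨x, hx, h⟩⟩) hc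
  have hdis : ∀ x ∈ X, x ∈ S → x ∉ S' := fun x hx h1 h2 => (hX hx).2 ⟨h1, h2⟩
  have hα : 0 < α := by
    obtain ⟨t, ht, hS⟩ := hT
    obtain ⟨β, hβ, -⟩ := h'.2 {t} (by rintro _ rfl; exact ⟨trivial, hdis _ ht hS⟩)
      ⟨singleton_nonempty t, by rintro _ rfl _ rfl; exact .refl⟩
    exact (zero_le (a := β)).trans_lt hβ
  obtain ⟨β, hβ, hA⟩ := rk_finite_comps hs hα (U := X \ S') (T := X ∩ S)
    (fun Y hY hc => h'.2 Y (fun y hy => ⟨trivial, (hY hy).2⟩) hc) (h.1.inter_of_right _)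
    (fun x hx => ⟨hx.1, hdis x hx.1 hx.2⟩)
  obtain ⟨γ, hγ, hB⟩ := rk_finite_comps hs hα (U := X \ S) (T := X ∩ S')
    (fun Y hY hc => h.2 Y (fun y hy => ⟨trivial, (hY hy).2⟩) hc) (h'.1.inter_of_right _)
    (fun x hx => ⟨hx.1, fun h => hdis x hx.1 h hx.2⟩)
  set A := {x | ∃ t ∈ X ∩ S, ReflTransGen (ROn r (X \ S')) t x} with hAdef
  set A' := {x | ∃ t ∈ X ∩ S', ReflTransGen (ROn r (X \ S)) t x} with hA'def
  have hAsub : ∀ x ∈ A, x ∈ X \ S' := by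
    rintro x ⟨t, ht, hx⟩
    exact compOf_subset (r := r) (U := X \ S') (t := t) ⟨ht.1, hdis t ht.1 ht.2⟩ hx
  have hAcl : ∀ x ∈ A, ∀ y ∈ X \ S', r x y → y ∈ A := by
    rintro x hx y hy hxy
    obtain ⟨t, ht, h⟩ := id hx
    exact ⟨t, ht, h.tail ⟨hxy, hAsub x hx, hy⟩⟩
  -- the part of X \ S' outside A
  have hBsub : (X \ S') \ A ⊆ A' := by
    obtain ⟨t', ht'X, ht'⟩ := hT'
    rintro x ⟨hx, hxA⟩
    have := hc.2 x hx.1 t' ht'X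
    clear hT
    induction this using ReflTransGen.head_induction_on with
    | refl => exact absurd ht' hx.2
    | @head a c hac _ ih =>
      have haS : a ∉ S := fun h => hxA ⟨a, ⟨hx.1, h⟩, .refl⟩
      by_cases hcS' : c ∈ S'
      · exact ⟨c, ⟨hac.2.2, hcS'⟩, .single ⟨hs _ _ hac.1,
          ⟨hac.2.2, fun h => hdis c hac.2.2 h hcS'⟩, ⟨hx.1, haS⟩⟩⟩
      · have hcA : c ∉ A := fun h => hxA (hAcl c h a hx (hs _ _ hac.1))
        obtain ⟨t, ht, hr⟩ := ih ⟨hac.2.2, hcS'⟩ hcA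
        have hcS : c ∉ S := fun h => hcA ⟨c, ⟨hac.2.2, h⟩, .refl⟩
        exact ⟨t, ht, hr.tail ⟨hs _ _ hac.1, ⟨hac.2.2, hcS⟩, ⟨hx.1, haS⟩⟩⟩
  refine ⟨max β γ, max_lt hβ hγ, rk_mono ?_ (rk_union_fin h'.1 (rk_union_sep hs (U := A)
    (U' := (X \ S') \ A) ?_
    (rk_le (le_max_left β γ) hA) (rk_le (le_max_right β γ) (rk_mono hBsub hB))))⟩
  · intro x hx
    by_cases h1 : x ∈ S'
    · exact Or.inr h1
    · by_cases h2 : x ∈ A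
      · exact Or.inl (Or.inl h2)
      · exact Or.inl (Or.inr ⟨⟨hx, h1⟩, h2⟩)
  · exact fun x hx y hy hxy => hy.2 (hAcl x hx y hy.1 hxy)

/-- the rank -/
noncomputable def rk (r : V → V → Prop) : Ordinal.{u} := sInf {α | Rk r α univ}

/-- the kernel -/
def ker (r : V → V → Prop) : Set V := {v | ∀ K, GoodK r (rk r) univ K → v ∈ K}

def Ranked (r : V → V → Prop) : Prop := ∃ α, Rk r α univ

lemma Ranked.comap {r : V → V → Prop} {s : W → W → Prop} {f : V → W}
    (hinj : Function.Injective f)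
    (hf : ∀ x y, r x y → s (f x) (f y)) (h : Ranked s) : Ranked r := by
  obtain ⟨α, h⟩ := h
  exact ⟨α, rk_comap hinj hf α _ _ (subset_univ _) h⟩

lemma Ranked.rk {r : V → V → Prop} (h : Ranked r) : Rk r (rk r) univ := csInf_mem h

lemma rk_lt {r : V → V → Prop} {α : Ordinal.{u}} (h : α < rk r) : ¬ Rk r α univ :=
  fun h' => notMem_of_lt_csInf' (s := {α | Rk r α univ}) h h'

lemma rk_rk_le {r : V → V → Prop} {α : Ordinal.{u}} (h : Rk r α univ) : rk r ≤ α :=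
  csInf_le' h

lemma ker_good {r : V → V → Prop} (hs : ∀ x y, r x y → r y x) (h : Ranked r) :
    GoodK r (rk r) univ (ker r) := by
  classical
  obtain ⟨K₀, hK₀⟩ := rk_iff.1 h.rk
  have hne : {n : ℕ | ∃ K, GoodK r (rk r) univ K ∧ K.ncard = n}.Nonempty := ⟨_, K₀, hK₀, rfl⟩
  obtain ⟨K, hK, hn⟩ := Nat.sInf_mem hne
  have : ker r = K := by
    apply subset_antisymm (fun v hv => hv K hK)
    intro v hv K' hK'
    have h1 := good_inter hs hK hK'
    have h2 : K.ncard ≤ (K ∩ K').ncard := by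
      rw [hn]; exact Nat.sInf_le ⟨_, h1, rfl⟩
    have h3 := Set.eq_of_subset_of_ncard_le inter_subset_left h2 hK.1
    rw [← h3] at hv
    exact hv.2
  rw [this]; exact hK

lemma ker_nonempty {r : V → V → Prop} (hs : ∀ x y, r x y → r y x) (h : Ranked r)
    (hc : ConnOn r univ) : (ker r).Nonempty := by
  by_contra hne
  rw [not_nonempty_iff_eq_empty] at hne
  have := (ker_good hs h).2 univ (by rw [hne]; simp) hc
  obtain ⟨β, hβ, hr⟩ := this
  exact rk_lt hβ hr

lemma rk_le_of_hom {r : V → V → Prop} {s : W → W → Prop} {f : V → W}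
    (hinj : Function.Injective f) (hf : ∀ x y, r x y → s (f x) (f y)) (h : Ranked s) :
    rk r ≤ rk s :=
  rk_rk_le (rk_comap hinj hf _ _ _ (subset_univ _) h.rk)

lemma ker_maps {r : V → V → Prop} {s : W → W → Prop} {f : V → W} {g : W → V}
    (hr : Ranked r)
    (hinj : Function.Injective f) (hf : ∀ x y, r x y → s (f x) (f y))
    (ginj : Function.Injective g) (hg : ∀ x y, s x y → r (g x) (g y)) {v : V} (hv : v ∈ ker r) :
    f v ∈ ker s := by
  have hs := hr.comap ginj hg
  have e : rk r = rk s := le_antisymm (rk_le_of_hom hinj hf hs) (rk_le_of_hom ginj hg hr)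
  intro K hK
  rw [← e] at hK
  exact hv _ (good_comap hinj hf hK)

lemma ker_image {r : V → V → Prop} {s : W → W → Prop} {f : V → W} {g : W → V}
    (hsr : ∀ x y, r x y → r y x) (hr : Ranked r) (hss : ∀ x y, s x y → s y x)
    (hinj : Function.Injective f) (hf : ∀ x y, r x y → s (f x) (f y))
    (ginj : Function.Injective g) (hg : ∀ x y, s x y → r (g x) (g y)) :
    f '' ker r = ker s := by
  have hs := hr.comap ginj hg
  have h1 : f '' ker r ⊆ ker s := by
    rintro _ ⟨v, hv, rfl⟩
    exact ker_maps hr hinj hf ginj hg hv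
  have h2 : g '' ker s ⊆ ker r := by
    rintro _ ⟨v, hv, rfl⟩
    exact ker_maps hs ginj hg hinj hf hv
  have f1 := (ker_good hsr hr).1
  have f2 := (ker_good hss hs).1
  apply Set.eq_of_subset_of_ncard_le h1 _ f2
  rw [ncard_image_of_injective _ hinj, ← ncard_image_of_injective (ker s) ginj]
  exact ncard_le_ncard h2 f1

/-- rayless implies ranked -/
lemma ranked_of_rayless {r : V → V → Prop} (hs : ∀ x y, r x y → r y x)
    (h : ¬ ∃ f : ℕ → V, Function.Injective f ∧ ∀ n, r (f n) (f (n + 1))) : Ranked r := by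
  classical
  by_contra hR
  have step0 : ∀ U : Set V, (¬ ∃ α, Rk r α U) → ∀ K : Set V, K.Finite →
      ∃ X, X ⊆ U \ K ∧ ConnOn r X ∧ ¬ ∃ α, Rk r α X := by
    intro U hU K hK
    by_contra hcon
    push Not at hcon
    apply hU
    choose! b hb using hcon
    refine ⟨Order.succ (⨆ X, b X), rk_iff.2 ⟨K, hK, fun X hX hc => ⟨b X, ?_, hb X hX hc⟩⟩⟩
    exact Order.lt_succ_of_le (le_ciSup (Ordinal.bddAbove_of_small) X)
  let St := {p : V × Set V // p.1 ∈ p.2 ∧ ConnOn r p.2 ∧ ¬ ∃ α, Rk r α p.2}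
  have step : ∀ p : St, ∃ q : St, r p.1.1 q.1.1 ∧ q.1.2 ⊆ p.1.2 \ {p.1.1} := by
    rintro ⟨⟨v, U⟩, hv, hc, hu⟩
    dsimp only at hv hc hu
    obtain ⟨X, hX, hXc, hXu⟩ := step0 U hu {v} (finite_singleton v)
    obtain ⟨w, hw⟩ := hXc.1
    have hsub : compOf r (U \ {v}) w ⊆ U \ {v} := compOf_subset (hX hw)
    have : ∃ v' ∈ compOf r (U \ {v}) w, r v v' := by
      by_contra hno
      push Not at hno
      have : v ∈ compOf r (U \ {v}) w := by
        refine reach_closed (P := (· ∈ compOf r (U \ {v}) w)) ?_ (hc.2 w (hX hw).1 v hv) .refl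
        rintro a b ha ⟨hab, haU, hbU⟩
        by_cases hbv : b = v
        · exact absurd (hs _ _ (hbv ▸ hab)) (hno a ha)
        · exact ReflTransGen.tail ha ⟨hab, hsub ha, ⟨hbU, hbv⟩⟩
      exact (hsub this).2 rfl
    obtain ⟨v', hv', hr'⟩ := this
    refine ⟨⟨⟨v', compOf r (U \ {v}) w⟩, hv', compOf_conn hs, ?_⟩, hr', hsub⟩
    rintro ⟨α, hα⟩
    exact hXu ⟨α, rk_mono (conn_subset_compOf hXc hX hw) hα⟩
  choose nx hn1 hn2 using step
  obtain ⟨X, -, hXc, hXu⟩ := step0 univ hR ∅ finite_empty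
  obtain ⟨x, hx⟩ := hXc.1
  let p0 : St := ⟨⟨x, X⟩, hx, hXc, hXu⟩
  let p : ℕ → St := fun n => nx^[n] p0
  have hp : ∀ n, p (n + 1) = nx (p n) := fun n => Function.iterate_succ_apply' _ _ _
  have hmono : ∀ n k, (p (n + 1 + k)).1.2 ⊆ (p n).1.2 \ {(p n).1.1} := by
    intro n k
    induction k with
    | zero => rw [add_zero, hp]; exact hn2 _
    | succ k ih =>
      rw [← add_assoc, hp]
      exact ((hn2 _).trans sdiff_subset).trans ih
  have hne : ∀ n m, n < m → (p n).1.1 ≠ (p m).1.1 := by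
    intro n m hnm he
    obtain ⟨k, rfl⟩ := Nat.exists_eq_add_of_le hnm
    exact (hmono n k (p (n + 1 + k)).2.1).2 he.symm
  refine h ⟨fun n => (p n).1.1, ?_, fun n => ?_⟩
  · intro n m he
    rcases lt_trichotomy n m with h | h | h
    · exact absurd he (hne _ _ h)
    · exact h
    · exact absurd he.symm (hne _ _ h)
  · show r (p n).1.1 (p (n+1)).1.1
    rw [hp]; exact hn1 _

end Rank

section Labelled

/-- Labelled graphs (loops allowed). -/
structure LG (L : Type u) where
  V : Type u
  Adj : V → V → Prop
  symm : ∀ x y, Adj x y → Adj y x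
  lab : V → L → Prop

variable {L : Type u}

structure IsEmb (G H : LG L) (f : G.V → H.V) : Prop where
  inj : Function.Injective f
  adj : ∀ x y, G.Adj x y → H.Adj (f x) (f y)
  lab : ∀ x l, G.lab x l → H.lab (f x) l

def Le (G H : LG L) : Prop := ∃ f, IsEmb G H f

def Tw (G H : LG L) : Prop := Le G H ∧ Le H G

structure IsIso (G H : LG L) (e : G.V ≃ H.V) : Prop where
  adj : ∀ x y, G.Adj x y ↔ H.Adj (e x) (e y)
  lab : ∀ x l, G.lab x l ↔ H.lab (e x) l

def Iso (G H : LG L) : Prop := ∃ e, IsIso G H e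

def Conn (G : LG L) : Prop := Nonempty G.V ∧ ∀ x y, ReflTransGen G.Adj x y

lemma IsEmb.comp {G H J : LG L} {f : G.V → H.V} {g : H.V → J.V} (hg : IsEmb H J g)
    (hf : IsEmb G H f) : IsEmb G J (g ∘ f) :=
  ⟨hg.inj.comp hf.inj, fun _ _ h => hg.adj _ _ (hf.adj _ _ h), fun _ _ h => hg.lab _ _ (hf.lab _ _ h)⟩

lemma isEmb_id (G : LG L) : IsEmb G G id := ⟨Function.injective_id, fun _ _ h => h, fun _ _ h => h⟩

lemma Le.refl (G : LG L) : Le G G := ⟨_, isEmb_id G⟩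

lemma Le.trans {G H J : LG L} (h : Le G H) (h' : Le H J) : Le G J := by
  obtain ⟨f, hf⟩ := h
  obtain ⟨g, hg⟩ := h'
  exact ⟨_, hg.comp hf⟩

lemma Tw.refl (G : LG L) : Tw G G := ⟨.refl G, .refl G⟩
lemma Tw.symm {G H : LG L} (h : Tw G H) : Tw H G := ⟨h.2, h.1⟩
lemma Tw.trans {G H J : LG L} (h : Tw G H) (h' : Tw H J) : Tw G J :=
  ⟨h.1.trans h'.1, h'.2.trans h.2⟩

lemma IsIso.symm {G H : LG L} {e : G.V ≃ H.V} (h : IsIso G H e) : IsIso H G e.symm :=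
  ⟨fun x y => by rw [h.adj]; simp, fun x l => by rw [h.lab]; simp⟩

lemma IsIso.trans {G H J : LG L} {e : G.V ≃ H.V} {e' : H.V ≃ J.V} (h : IsIso G H e)
    (h' : IsIso H J e') : IsIso G J (e.trans e') :=
  ⟨fun x y => by rw [h.adj, h'.adj]; simp, fun x l => by rw [h.lab, h'.lab]; simp⟩

lemma IsIso.isEmb {G H : LG L} {e : G.V ≃ H.V} (h : IsIso G H e) : IsEmb G H e :=
  ⟨e.injective, fun x y => (h.adj x y).1, fun x l => (h.lab x l).1⟩

lemma Iso.refl (G : LG L) : Iso G G := ⟨Equiv.refl _, ⟨fun _ _ => Iff.rfl, fun _ _ => Iff.rfl⟩⟩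
lemma Iso.symm {G H : LG L} (h : Iso G H) : Iso H G := by
  obtain ⟨e, h⟩ := h
  exact ⟨_, h.symm⟩
lemma Iso.trans {G H J : LG L} (h : Iso G H) (h' : Iso H J) : Iso G J := by
  obtain ⟨e, h⟩ := h
  obtain ⟨e', h'⟩ := h'
  exact ⟨_, h.trans h'⟩
lemma Iso.tw {G H : LG L} (h : Iso G H) : Tw G H := by
  obtain ⟨e, h⟩ := h
  exact ⟨⟨_, h.isEmb⟩, ⟨_, h.symm.isEmb⟩⟩

lemma Conn.connOn {G : LG L} (h : Conn G) : ConnOn G.Adj univ := by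
  refine ⟨?_, fun x _ y _ => ?_⟩
  · obtain ⟨x⟩ := h.1
    exact ⟨x, trivial⟩
  · exact reach_mono (fun _ _ h => ⟨h, trivial, trivial⟩) (h.2 x y)

lemma ranked_of_le {G H : LG L} (h : Le G H) (hH : Ranked H.Adj) : Ranked G.Adj := by
  obtain ⟨f, hf⟩ := h
  exact hH.comap hf.inj hf.adj

/-- no two disjoint copies inside a twin of a connected ranked graph -/
lemma no_two {C C' D : LG L} (hc : Conn C) (hr : Ranked D.Adj) (hC : Le D C)
    (hC' : Le D C') {p : C.V → D.V} {p' : C'.V → D.V} (hp : IsEmb C D p) (hp' : IsEmb C' D p')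
    (hd : ∀ x x', p x ≠ p' x') : False := by
  obtain ⟨q, hq⟩ := hC
  obtain ⟨q', hq'⟩ := hC'
  have r1 : Ranked C.Adj := hr.comap hp.inj hp.adj
  have r2 : Ranked C'.Adj := hr.comap hp'.inj hp'.adj
  have e1 := ker_image C.symm r1 D.symm hp.inj hp.adj hq.inj hq.adj
  have e2 := ker_image C'.symm r2 D.symm hp'.inj hp'.adj hq'.inj hq'.adj
  obtain ⟨v, hv⟩ := ker_nonempty C.symm r1 hc.connOn
  have : p v ∈ ker D.Adj := by rw [← e1]; exact ⟨v, hv, rfl⟩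
  rw [← e2] at this
  obtain ⟨w, -, hw⟩ := this
  exact hd v w hw.symm

/-- Disjoint unions -/
abbrev sumG {ι : Type u} (C : ι → LG L) : LG L where
  V := Σ i, (C i).V
  Adj a b := ∃ i x y, a = ⟨i, x⟩ ∧ b = ⟨i, y⟩ ∧ (C i).Adj x y
  symm := by
    rintro _ _ ⟨i, x, y, rfl, rfl, h⟩
    exact ⟨i, y, x, rfl, rfl, (C i).symm _ _ h⟩
  lab a l := (C a.1).lab a.2 l

variable {ι κ : Type u}

lemma smk_inj {F : ι → Type u} {i : ι} {x y : F i}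
    (h : (⟨i, x⟩ : Σ i, F i) = ⟨i, y⟩) : x = y := by
  cases h
  rfl

lemma sum_adj {C : ι → LG L} {i : ι} {x y : (C i).V} :
    (sumG C).Adj ⟨i, x⟩ ⟨i, y⟩ ↔ (C i).Adj x y := by
  constructor
  · rintro ⟨j, x', y', h1, h2, h⟩
    cases h1
    cases h2
    exact h
  · intro h
    exact ⟨i, x, y, rfl, rfl, h⟩

lemma incl_emb (C : ι → LG L) (i : ι) : IsEmb (C i) (sumG C) (fun x => (⟨i, x⟩ : Σ i, (C i).V)) :=
  ⟨fun _ _ h => smk_inj (F := fun i => (C i).V) h, fun _ _ h => sum_adj.2 h, fun _ _ h => h⟩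

lemma hat {C : ι → LG L} {D : κ → LG L} (hC : ∀ i, Conn (C i)) {f : (sumG C).V → (sumG D).V}
    (hf : IsEmb (sumG C) (sumG D) f) :
    ∃ (h : ι → κ) (p : ∀ i, (C i).V → (D (h i)).V),
      (∀ i x, f ⟨i, x⟩ = ⟨h i, p i x⟩) ∧ ∀ i, IsEmb (C i) (D (h i)) (p i) := by
  have h1 : ∀ i x y, (f ⟨i, x⟩).1 = (f ⟨i, y⟩).1 := by
    intro i x y
    refine reach_closed (P := fun y => (f ⟨i, x⟩).1 = (f ⟨i, y⟩).1) ?_ ((hC i).2 x y) rfl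
    intro a b ha hab
    obtain ⟨j, x', y', e1, e2, -⟩ := hf.adj ⟨i, a⟩ ⟨i, b⟩ (sum_adj.2 hab)
    rw [ha, e1, e2]
  have h2 : ∀ i, ∃ j, ∀ x, ∃ y, f ⟨i, x⟩ = ⟨j, y⟩ := by
    intro i
    obtain ⟨x0⟩ := (hC i).1
    refine ⟨(f ⟨i, x0⟩).1, fun x => ?_⟩
    rw [h1 i x0 x]
    exact ⟨_, rfl⟩
  choose h p hp using h2
  refine ⟨h, p, hp, fun i => ⟨?_, ?_, ?_⟩⟩
  · intro x y hxy
    have : f ⟨i, x⟩ = f ⟨i, y⟩ := by rw [hp, hp, hxy]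
    exact smk_inj (F := fun i => (C i).V) (hf.inj this)
  · intro x y hxy
    have := hf.adj ⟨i, x⟩ ⟨i, y⟩ (sum_adj.2 hxy)
    rw [hp, hp] at this
    exact sum_adj.1 this
  · intro x l hl
    have := hf.lab ⟨i, x⟩ l hl
    rw [hp] at this
    exact this

lemma sum_le {C : ι → LG L} {D : κ → LG L} (Q : ∀ i j, ((C i).V → (D j).V) → Prop)
    (h : ∀ i, ∃ j p, IsEmb (C i) (D j) p ∧ Q i j p)
    (hd : ∀ i i' j p p', i ≠ i' → Q i j p → Q i' j p' → ∀ x x', p x ≠ p' x') :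
    Le (sumG C) (sumG D) := by
  choose h p hp hQ using h
  refine ⟨fun a => ⟨h a.1, p a.1 a.2⟩, ?_, ?_, ?_⟩
  · rintro ⟨i, x⟩ ⟨i', x'⟩ he
    dsimp only at he
    by_cases hii : i = i'
    · subst hii
      rw [(hp i).inj (smk_inj (F := fun i => (D i).V) he)]
    · exfalso
      have key : ∀ j (q : (C i).V → (D j).V), h i = j → HEq (p i) q → Q i j q := by
        rintro j q rfl hq
        cases hq
        exact hQ i
      have hj : h i = h i' := congrArg Sigma.fst he
      have := hQ i'
      have h2 := hQ i
      generalize p i = q at *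
      generalize p i' = q' at *
      generalize h i = j at *
      generalize h i' = j' at *
      subst hj
      exact hd i i' j q q' hii h2 this x x' (smk_inj (F := fun i => (D i).V) he)
  · rintro _ _ ⟨i, x, y, rfl, rfl, hxy⟩
    exact sum_adj.2 ((hp i).adj _ _ hxy)
  · rintro ⟨i, x⟩ l hl
    exact (hp i).lab _ _ hl

lemma sum_le_inj {C : ι → LG L} {D : κ → LG L} (h : ι → κ) (hi : Function.Injective h)
    (hle : ∀ i, Le (C i) (D (h i))) : Le (sumG C) (sumG D) := by
  refine sum_le (fun i j _ => h i = j) (fun i => ?_) ?_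
  · obtain ⟨p, hp⟩ := hle i
    exact ⟨_, p, hp, rfl⟩
  · intro i i' j _ _ hne h1 h2
    exact absurd (hi (h1.trans h2.symm)) hne

lemma sum_iso {C : ι → LG L} {D : κ → LG L} (σ : ι ≃ κ)
    (h : ∀ i, Iso (C i) (D (σ i))) : Iso (sumG C) (sumG D) := by
  choose e he using h
  refine ⟨Equiv.sigmaCongr σ e, ?_, ?_⟩
  · rintro ⟨i, x⟩ ⟨j, y⟩
    constructor
    · rintro ⟨i, x, y, h1, h2, h⟩
      cases h1
      cases h2
      exact sum_adj.2 (((he _).adj _ _).1 h)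
    · rintro ⟨k, x', y', h1, h2, h⟩
      have h3 : σ i = k := congrArg Sigma.fst h1
      have h4 : σ j = k := congrArg Sigma.fst h2
      have h5 : i = j := σ.injective (h3.trans h4.symm)
      subst h5
      subst h3
      have h1' : e i x = x' := eq_of_heq (Sigma.mk.inj h1).2
      have h2' : e i y = y' := eq_of_heq (Sigma.mk.inj h2).2
      refine sum_adj.2 (((he _).adj _ _).2 ?_)
      rw [h1', h2']; exact h
  · rintro ⟨i, x⟩ l
    exact (he i).lab x l

lemma iso_sum {C : ι → LG L} {D : κ → LG L} (hC : ∀ i, Conn (C i)) (hD : ∀ i, Conn (D i))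
    (h : Iso (sumG C) (sumG D)) : ∃ σ : ι ≃ κ, ∀ i, Iso (C i) (D (σ i)) := by
  obtain ⟨e, he⟩ := h
  obtain ⟨s, p, hp, hpe⟩ := hat hC he.isEmb
  obtain ⟨t, q, hq, hqe⟩ := hat hD he.symm.isEmb
  have hts : ∀ i x, (⟨t (s i), q _ (p i x)⟩ : Σ i, (C i).V) = ⟨i, x⟩ := by
    intro i x
    rw [← hq, ← hp, e.symm_apply_apply]
  have hst : ∀ i x, (⟨s (t i), p _ (q i x)⟩ : Σ i, (D i).V) = ⟨i, x⟩ := by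
    intro i x
    rw [← hp, ← hq, e.apply_symm_apply]
  refine ⟨⟨s, t, ?_, ?_⟩, ?_⟩
  · intro i
    obtain ⟨x⟩ := (hC i).1
    exact congrArg Sigma.fst (hts i x)
  · intro i
    obtain ⟨x⟩ := (hD i).1
    exact congrArg Sigma.fst (hst i x)
  · intro i
    show Iso (C i) (D (s i))
    have hsur : Function.Surjective (p i) := by
      intro y
      have h1 := hst (s i) y
      have h2 : t (s i) = i := by
        obtain ⟨x⟩ := (hC i).1
        exact congrArg Sigma.fst (hts i x)
      generalize q (s i) y = z at h1
      revert z
      rw [h2]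
      intro z hz
      exact ⟨z, smk_inj (F := fun i => (D i).V) hz⟩
    refine ⟨Equiv.ofBijective (p i) ⟨(hpe i).inj, hsur⟩, ?_, ?_⟩
    · intro x y
      show _ ↔ (D (s i)).Adj (p i x) (p i y)
      rw [← sum_adj, he.adj, hp, hp, sum_adj]
    · intro x l
      show _ ↔ (D (s i)).lab (p i x) l
      have := he.lab ⟨i, x⟩ l
      rw [hp] at this
      exact this

/-- decomposition into components -/
lemma decomp (G : LG L) : ∃ (ι : Type u) (C : ι → LG L), (∀ i, Conn (C i)) ∧ Iso G (sumG C) := by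
  let S : Setoid G.V := ⟨ReflTransGen G.Adj, fun _ => .refl, reach_symm G.symm,
    fun h h' => h.trans h'⟩
  let C : Quotient S → LG L := fun q =>
    ⟨{v // Quotient.mk S v = q}, fun a b => G.Adj a.1 b.1, fun _ _ h => G.symm _ _ h,
      fun a l => G.lab a.1 l⟩
  refine ⟨Quotient S, C, ?_, (Equiv.sigmaFiberEquiv (Quotient.mk S)).symm, ?_, ?_⟩
  · intro q
    induction q using Quotient.inductionOn with
    | h v =>
      have key : ∀ w (hw : ReflTransGen G.Adj v w), ReflTransGen (C (Quotient.mk S v)).Adj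
          ⟨v, rfl⟩ ⟨w, (Quotient.sound (s := S) hw).symm⟩ := by
        intro w hw
        induction hw with
        | refl => exact .refl
        | tail h1 h2 ih => exact ih.tail h2
      refine ⟨⟨⟨v, rfl⟩⟩, ?_⟩
      rintro ⟨x, hx⟩ ⟨y, hy⟩
      have hx' := key x (Quotient.exact hx.symm)
      have hy' := key y (Quotient.exact hy.symm)
      exact (reach_symm (C _).symm hx').trans hy'
  · intro x y
    constructor
    · intro h
      have e : Quotient.mk S x = Quotient.mk S y := Quotient.sound (.single h)
      refine ⟨Quotient.mk S y, ⟨x, e⟩, ⟨y, rfl⟩, ?_, rfl, h⟩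
      rw [Equiv.symm_apply_eq]; rfl
    · rintro ⟨i, a, b, h1, h2, h⟩
      rw [Equiv.symm_apply_eq] at h1 h2
      subst h1 h2
      exact h
  · intro x l
    exact Iff.rfl

/-- many pairwise non-isomorphic twins of `sumG C`, given as sums of connected graphs -/
def Res (C : ι → LG L) (D : κ → LG L) : Prop :=
  ∃ (X : ℕ → Type u) (E : ∀ n, X n → LG L), (∀ n x, Conn (E n x)) ∧
    (∀ n x, (∃ i, Le (C i) (E n x)) ∨ ∃ j, Le (D j) (E n x)) ∧
    (∀ n, Tw (sumG (E n)) (sumG C)) ∧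
    ∀ n m, n ≠ m → ¬ Iso (sumG (E n)) (sumG (E m))

lemma Res.swap {C : ι → LG L} {D : κ → LG L} (h : Res D C) (ht : Tw (sumG C) (sumG D)) :
    Res C D := by
  obtain ⟨X, E, h1, h2, h3, h4⟩ := h
  exact ⟨X, E, h1, fun n x => (h2 n x).symm, fun n => (h3 n).trans ht.symm, h4⟩

/-- `C` together with `T` many copies of `C₀` -/
abbrev addC (C : ι → LG L) (C₀ : LG L) (T : Type u) : ι ⊕ T → LG L := Sum.elim C (fun _ => C₀)

def GoodT (C : ι → LG L) (C₀ : LG L) (T : Type u) : Prop := Le (sumG (addC C C₀ T)) (sumG C)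

lemma GoodT.of_inj {C : ι → LG L} {C₀ : LG L} {T T' : Type u} (h : GoodT C C₀ T) (f : T' → T)
    (hf : Function.Injective f) : GoodT C C₀ T' := by
  refine Le.trans (sum_le_inj (Sum.map id f) (Function.injective_id.sumMap hf) ?_) h
  rintro (i | t)
  · exact .refl _
  · exact .refl _

lemma goodT_empty {C : ι → LG L} {C₀ : LG L} : GoodT C C₀ PEmpty := by
  refine sum_le_inj (Sum.elim id PEmpty.elim) ?_ ?_
  · rintro (i | t) (j | s) h
    · exact congrArg _ h
    · exact s.elim
    · exact t.elim
    · exact t.elim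
  · rintro (i | t)
    · exact .refl _
    · exact t.elim

lemma GoodT.sum {C : ι → LG L} {C₀ : LG L} {T T' : Type u} (h : GoodT C C₀ T)
    (h' : GoodT C C₀ T') : GoodT C C₀ (T ⊕ T') := by
  refine Le.trans ?_ h'
  obtain ⟨f, hf⟩ := h
  let F : (Σ i, (addC C C₀ (T ⊕ T') i).V) → (Σ i, (addC C C₀ T' i).V) := fun a =>
    match a with
    | ⟨.inl i, x⟩ => ⟨.inl (f ⟨.inl i, x⟩).1, (f ⟨.inl i, x⟩).2⟩
    | ⟨.inr (.inl t), x⟩ => ⟨.inl (f ⟨.inr t, x⟩).1, (f ⟨.inr t, x⟩).2⟩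
    | ⟨.inr (.inr t), x⟩ => ⟨.inr t, x⟩
  let J : (Σ i, (C i).V) → (Σ i, (addC C C₀ T' i).V) := fun a => ⟨.inl a.1, a.2⟩
  have hJ : Function.Injective J := by
    rintro ⟨i, x⟩ ⟨j, y⟩ hxy
    cases hxy
    rfl
  have hJadj : ∀ a b, (sumG C).Adj a b → (sumG (addC C C₀ T')).Adj (J a) (J b) := by
    rintro _ _ ⟨i, x, y, rfl, rfl, h⟩
    exact ⟨.inl i, x, y, rfl, rfl, h⟩
  have hJr : ∀ a t (x : C₀.V), J a ≠ ⟨.inr t, x⟩ := by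
    intro a t x h
    cases h
  refine ⟨F, ?_, ?_, ?_⟩
  · rintro ⟨i | t | t, x⟩ ⟨j | s | s, y⟩ he
    · have := hf.inj (hJ he)
      cases this
      rfl
    · have := hf.inj (hJ he)
      cases this
    · exact absurd he (hJr _ _ _)
    · have := hf.inj (hJ he)
      cases this
    · have := hf.inj (hJ he)
      cases this
      rfl
    · exact absurd he (hJr _ _ _)
    · exact absurd he.symm (hJr _ _ _)
    · exact absurd he.symm (hJr _ _ _)
    · cases he
      rfl
  · rintro _ _ ⟨i | t | t, x, y, rfl, rfl, h⟩
    · exact hJadj _ _ (hf.adj ⟨.inl i, x⟩ ⟨.inl i, y⟩ ⟨.inl i, x, y, rfl, rfl, h⟩)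
    · exact hJadj _ _ (hf.adj ⟨.inr t, x⟩ ⟨.inr t, y⟩ ⟨.inr t, x, y, rfl, rfl, h⟩)
    · exact ⟨.inr t, x, y, rfl, rfl, h⟩
  · rintro ⟨i | t | t, x⟩ l h
    · exact hf.lab ⟨.inl i, x⟩ l h
    · exact hf.lab ⟨.inr t, x⟩ l h
    · exact h

lemma goodT_finite {C : ι → LG L} {C₀ : LG L} (h1 : GoodT C C₀ PUnit) (T : Type u) [Finite T] :
    GoodT C C₀ T := by
  induction T using Finite.induction_empty_option with
  | of_equiv e h => exact h.of_inj e.symm e.symm.injective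
  | h_empty => exact goodT_empty
  | h_option h =>
    exact (h.sum h1).of_inj (Equiv.optionEquivSumPUnit _) (Equiv.injective _)

/-- the case where a multiplicity is different -/
lemma union_mult {C : ι → LG L} {D : κ → LG L} (hC : ∀ i, Conn (C i)) (hD : ∀ j, Conn (D j))
    (hr : Ranked (sumG C).Adj) (ht : Tw (sumG C) (sumG D)) (C₀ : LG L) (hC₀ : Conn C₀)
    (hlt : Cardinal.mk {i // Tw (C i) C₀} < Cardinal.mk {j // Tw (D j) C₀}) : Res C D := by
  classical
  obtain ⟨⟨f, hf⟩, g, hg⟩ := ht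
  obtain ⟨fh, fp, hfp, hfe⟩ := hat hC hf
  obtain ⟨gh, gp, hgp, hge⟩ := hat hD hg
  have hrC : ∀ i, Ranked (C i).Adj := fun i => ranked_of_le ⟨_, incl_emb C i⟩ hr
  -- strictly above
  let I1 : ι → Prop := fun i => Le C₀ (C i) ∧ ¬ Le (C i) C₀
  let J1 : κ → Prop := fun j => Le C₀ (D j) ∧ ¬ Le (D j) C₀
  have hf1 : ∀ i, I1 i → J1 (fh i) := fun i hi =>
    ⟨hi.1.trans ⟨_, hfe i⟩, fun h => hi.2 (Le.trans ⟨_, hfe i⟩ h)⟩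
  have hg1 : ∀ j, J1 j → I1 (gh j) := fun i hi =>
    ⟨hi.1.trans ⟨_, hge i⟩, fun h => hi.2 (Le.trans ⟨_, hge i⟩ h)⟩
  let A := {j // Tw (D j) C₀ ∧ I1 (gh j)}
  let B := {j // Tw (D j) C₀ ∧ ¬ I1 (gh j)}
  have hB : ∀ b : B, Tw (C (gh b.1)) C₀ := by
    rintro ⟨j, hj, hn⟩
    have h1 : Le C₀ (C (gh j)) := hj.2.trans ⟨_, hge j⟩
    exact ⟨by_contra fun h => hn ⟨h1, h⟩, h1⟩
  have hBc : Cardinal.mk B ≤ Cardinal.mk {i // Tw (C i) C₀} := by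
    refine Cardinal.mk_le_of_injective (f := fun b : B => ⟨gh b.1, hB b⟩) ?_
    rintro ⟨j, hj⟩ ⟨j', hj'⟩ he
    have he' : gh j = gh j' := congrArg Subtype.val he
    by_contra hne
    have hne' : j ≠ j' := fun h => hne (Subtype.ext h)
    have hb := hB ⟨j, hj⟩
    have hdisj : ∀ x x', (⟨gh j, gp j x⟩ : Σ i, (C i).V) ≠ ⟨gh j', gp j' x'⟩ := by
      intro x x' h
      rw [← hgp, ← hgp] at h
      exact hne' (congrArg Sigma.fst (hg.inj h))
    have e1 := hge j
    have e2 := hge j'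
    dsimp only at hb
    have hj1 := hj.1
    have hj1' := hj'.1
    clear hne he hj hj'
    generalize gp j = p at *
    generalize gp j' = p' at *
    generalize gh j = k at *
    generalize gh j' = k' at *
    subst he'
    exact no_two (hD j) (hrC k) (hb.trans hj1.symm).1 (hb.trans hj1'.symm).1 e1 e2
      (fun x x' h => hdisj x x' (by rw [h]))
  have hsum : Cardinal.mk {j // Tw (D j) C₀} ≤ Cardinal.mk A + Cardinal.mk B := by
    rw [Cardinal.add_def]
    refine Cardinal.mk_le_of_injective
      (f := fun j => if h : I1 (gh j.1) then Sum.inl ⟨j.1, j.2, h⟩ else Sum.inr ⟨j.1, j.2, h⟩) ?_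
    rintro ⟨j, hj⟩ ⟨j', hj'⟩ he
    dsimp only at he
    split_ifs at he
    · have h := Sum.inl.inj he
      have h3 := congrArg Subtype.val h
      exact Subtype.ext h3
    · have h := Sum.inr.inj he
      have h3 := congrArg Subtype.val h
      exact Subtype.ext h3
  have hA0 : Nonempty A := by
    by_contra h
    rw [not_nonempty_iff] at h
    rw [Cardinal.mk_eq_zero A, zero_add] at hsum
    exact absurd (hsum.trans hBc) (not_le.2 hlt)
  have hA1 : Infinite {i // Tw (C i) C₀} → Cardinal.mk {i // Tw (C i) C₀} ≤ Cardinal.mk A := by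
    intro hinf
    by_contra hcon
    rw [not_le] at hcon
    have h2 := hsum.trans (add_le_add hcon.le hBc)
    rw [Cardinal.add_eq_self (Cardinal.infinite_iff.1 hinf)] at h2
    exact absurd h2 (not_le.2 hlt)
  -- the rest
  let ι₀ := {i // ¬ Tw (C i) C₀}
  let C' : ι₀ → LG L := fun i => C i.1
  have hM : GoodT C' C₀ A := by
    let Q : ∀ (i : ι₀ ⊕ A) (j : ι₀), ((addC C' C₀ A i).V → (C' j).V) → Prop := fun i j =>
      match i with
      | .inl i => fun p => (I1 i.1 ∧ I1 j.1 ∧ ∀ x, (⟨j.1, p x⟩ : Σ i, (C i).V) = g (f ⟨i.1, x⟩)) ∨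
          (¬ I1 i.1 ∧ j = i)
      | .inr t => fun p => I1 j.1 ∧ ∀ x, ∃ y, (⟨j.1, p x⟩ : Σ i, (C i).V) = g ⟨t.1, y⟩
    refine sum_le Q ?_ ?_
    · rintro (⟨i, hi⟩ | ⟨t, ht, hI⟩)
      · by_cases h : I1 i
        · have h2 := hg1 _ (hf1 i h)
          refine ⟨⟨gh (fh i), fun hh => h2.2 hh.1⟩, gp _ ∘ fp i, (hge _).comp (hfe i),
            Or.inl ⟨h, h2, fun x => ?_⟩⟩
          exact ((congrArg g (hfp i x)).trans (hgp _ _)).symm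
        · exact ⟨⟨i, hi⟩, id, isEmb_id _, Or.inr ⟨h, rfl⟩⟩
      · obtain ⟨q, hq⟩ := ht.2
        refine ⟨⟨gh t, fun hh => hI.2 hh.1⟩, gp t ∘ q, (hge t).comp hq, hI, fun x => ⟨q x, ?_⟩⟩
        exact (hgp _ _).symm
    · have sym : ∀ (i : ι₀) (t : A) (j : ι₀) (p : (C' i).V → (C' j).V) (p' : C₀.V → (C' j).V),
          Q (.inl i) j p → Q (.inr t) j p' → ∀ x x', p x ≠ p' x' := by
        rintro i t j p p' (⟨h1, h2, h3⟩ | ⟨h1, h2⟩) ⟨h4, h5⟩ x x' he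
        · obtain ⟨y, hy⟩ := h5 x'
          have hy2 : g (f ⟨i.1, x⟩) = g ⟨t.1, y⟩ :=
            (h3 x).symm.trans ((congrArg (fun z => (⟨j.1, z⟩ : Σ i, (C i).V)) he).trans hy)
          have h6 : fh i.1 = t.1 :=
            congrArg Sigma.fst ((hfp i.1 x).symm.trans (hg.inj hy2))
          have := (hf1 _ h1).2
          rw [h6] at this
          exact this t.2.1.1
        · rw [h2] at h4
          exact h1 h4
      rintro (i | t) (i' | t') j p p' hne hQ hQ' x x' he
      · have hne' : i ≠ i' := fun h => hne (congrArg _ h)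
        rcases hQ with ⟨h1, h2, h3⟩ | ⟨h1, h2⟩ <;> rcases hQ' with ⟨h4, h5, h6⟩ | ⟨h4, h5⟩
        · have h7 : g (f ⟨i.1, x⟩) = g (f ⟨i'.1, x'⟩) :=
            (h3 x).symm.trans ((congrArg (fun z => (⟨j.1, z⟩ : Σ i, (C i).V)) he).trans (h6 x'))
          exact hne' (Subtype.ext (congrArg Sigma.fst (hf.inj (hg.inj h7))))
        · rw [h5] at h2
          exact h4 h2
        · rw [h2] at h5
          exact h1 h5
        · exact hne' (h2.symm.trans h5)
      · exact sym i t' j p p' hQ hQ' x x' he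
      · exact sym i' t j p' p hQ' hQ x' x he.symm
      · obtain ⟨y, hy⟩ := hQ.2 x
        obtain ⟨y', hy'⟩ := hQ'.2 x'
        have h7 : g ⟨t.1, y⟩ = g ⟨t'.1, y'⟩ :=
          hy.symm.trans ((congrArg (fun z => (⟨j.1, z⟩ : Σ i, (C i).V)) he).trans hy')
        exact hne (congrArg _ (Subtype.ext (congrArg Sigma.fst (hg.inj h7))))
  have hM1 : GoodT C' C₀ PUnit :=
    hM.of_inj (fun _ => Classical.arbitrary A) (fun _ _ _ => rfl)
  have hM2 : GoodT C' C₀ {i // Tw (C i) C₀} := by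
    rcases finite_or_infinite {i // Tw (C i) C₀} with h | h
    · exact goodT_finite hM1 _
    · obtain ⟨e⟩ := hA1 h
      exact hM.of_inj e e.injective
  have hle1 : Le (sumG C) (sumG C') := by
    refine Le.trans (sum_le (fun i j _ => Sum.elim Subtype.val Subtype.val j = i) ?_ ?_) hM2
    · intro i
      by_cases h : Tw (C i) C₀
      · obtain ⟨q, hq⟩ := h.1
        exact ⟨.inr ⟨i, h⟩, q, hq, rfl⟩
      · exact ⟨.inl ⟨i, h⟩, id, isEmb_id _, rfl⟩
    · intro i i' j _ _ hne h1 h2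
      exact absurd (h1.symm.trans h2) hne
  have hle2 : Le (sumG C') (sumG C) := sum_le_inj Subtype.val Subtype.val_injective
    (fun _ => .refl _)
  have hconn : ∀ (T : Type u) x, Conn (addC C' C₀ T x) := by
    rintro T (i | t)
    · exact hC _
    · exact hC₀
  have hcount : ∀ n m, Iso (sumG (addC C' C₀ (ULift (Fin n)))) (sumG (addC C' C₀ (ULift (Fin m)))) →
      n ≤ m := by
    intro n m h
    obtain ⟨σ, hσ⟩ := iso_sum (hconn _) (hconn _) h
    have : ∀ t : ULift.{u} (Fin n), ∃ s : ULift.{u} (Fin m), σ (.inr t) = .inr s := by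
      intro t
      have h1 := hσ (.inr t)
      rcases hh : σ (.inr t) with i | s
      · rw [hh] at h1
        exact absurd h1.tw.symm i.2
      · exact ⟨s, rfl⟩
    choose s hs using this
    have hinj : Function.Injective s := by
      intro a b hab
      have : σ (.inr a) = σ (.inr b) := by rw [hs, hs, hab]
      exact Sum.inr_injective (σ.injective this)
    simpa using Fintype.card_le_of_injective s hinj
  have hJ : ∃ j, Tw (D j) C₀ := by
    obtain ⟨a⟩ := hA0
    exact ⟨a.1, a.2.1⟩
  refine ⟨fun n => ι₀ ⊕ ULift (Fin n), fun n => addC C' C₀ (ULift (Fin n)), fun n => hconn _,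
    ?_, ?_, ?_⟩
  · rintro n (i | t)
    · exact Or.inl ⟨i.1, .refl _⟩
    · obtain ⟨j, hj⟩ := hJ
      exact Or.inr ⟨j, hj.1⟩
  · intro n
    refine Tw.trans ⟨goodT_finite hM1 _, ?_⟩ ⟨hle2, hle1⟩
    exact sum_le_inj Sum.inl Sum.inl_injective (fun _ => .refl _)
  · intro n m hne h
    exact hne (le_antisymm (hcount n m h) (hcount m n h.symm))

def ConnAlt (G : LG L) : Prop := ∀ H : LG L, Conn H → Tw G H → ¬ Iso G H →
  ∃ F : ℕ → LG L, (∀ n, Conn (F n) ∧ Tw (F n) G) ∧ ∀ n m, n ≠ m → ¬ Iso (F n) (F m)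

def twSetoid (L : Type u) : Setoid (LG L) := ⟨Tw, Tw.refl, Tw.symm, Tw.trans⟩

lemma union_step {C : ι → LG L} {D : κ → LG L} (hC : ∀ i, Conn (C i)) (hD : ∀ j, Conn (D j))
    (hr : Ranked (sumG C).Adj) (ht : Tw (sumG C) (sumG D)) (hn : ¬ Iso (sumG C) (sumG D))
    (hA : ∀ i, ConnAlt (C i)) : Res C D := by
  classical
  by_cases hm : ∀ C₀, Conn C₀ → Cardinal.mk {i // Tw (C i) C₀} = Cardinal.mk {j // Tw (D j) C₀}
  swap
  · push Not at hm
    obtain ⟨C₀, h0, hne⟩ := hm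
    rcases lt_or_gt_of_ne hne with h | h
    · exact union_mult hC hD hr ht C₀ h0 h
    · exact (union_mult hD hC (ranked_of_le ht.2 hr) ht.symm C₀ h0 h).swap ht
  let S := twSetoid L
  have hfib : ∀ q : Quotient S, Nonempty ({i // Quotient.mk S (C i) = q} ≃
      {j // Quotient.mk S (D j) = q}) := by
    intro q
    have main : ∀ C₀, Conn C₀ → Nonempty ({i // Quotient.mk S (C i) = Quotient.mk S C₀} ≃
      {j // Quotient.mk S (D j) = Quotient.mk S C₀}) := by
      intro C₀ h0
      obtain ⟨e⟩ := Cardinal.eq.1 (hm C₀ h0)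
      have hq : ∀ X : LG L, Quotient.mk S X = Quotient.mk S C₀ ↔ Tw X C₀ := fun X => Quotient.eq
      exact ⟨(Equiv.subtypeEquivRight fun i => hq _).trans
        (e.trans (Equiv.subtypeEquivRight fun i => (hq _).symm))⟩
    by_cases h1 : ∃ i, Quotient.mk S (C i) = q
    · obtain ⟨i, rfl⟩ := h1
      exact main _ (hC i)
    by_cases h2 : ∃ i, Quotient.mk S (D i) = q
    · obtain ⟨i, rfl⟩ := h2
      exact main _ (hD i)
    have : IsEmpty {i // Quotient.mk S (C i) = q} := ⟨fun x => h1 ⟨_, x.2⟩⟩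
    have : IsEmpty {i // Quotient.mk S (D i) = q} := ⟨fun x => h2 ⟨_, x.2⟩⟩
    exact ⟨Equiv.equivOfIsEmpty _ _⟩
  let ε := fun q => Classical.choice (hfib q)
  let σ : ι ≃ κ := (Equiv.sigmaFiberEquiv (fun i => Quotient.mk S (C i))).symm.trans
    ((Equiv.sigmaCongrRight ε).trans (Equiv.sigmaFiberEquiv (fun j => Quotient.mk S (D j))))
  have hσ : ∀ i, Tw (C i) (D (σ i)) := by
    intro i
    have : Quotient.mk S (D (σ i)) = Quotient.mk S (C i) := (ε (Quotient.mk S (C i)) ⟨i, rfl⟩).2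
    exact (Quotient.exact this).symm
  have : ∃ i, ¬ Iso (C i) (D (σ i)) := by
    by_contra h
    push Not at h
    exact hn (sum_iso σ h)
  obtain ⟨i₀, hi₀⟩ := this
  obtain ⟨F, hF, hFn⟩ := hA i₀ _ (hD _) (hσ i₀) hi₀
  let E : ℕ → ι → LG L := fun n i => if Tw (C i) (C i₀) then F n else C i
  have hE1 : ∀ n i, Tw (C i) (C i₀) → E n i = F n := fun n i h => if_pos h
  have hE2 : ∀ n i, ¬ Tw (C i) (C i₀) → E n i = C i := fun n i h => if_neg h
  have hEtw : ∀ n i, Tw (E n i) (C i) := by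
    intro n i
    by_cases h : Tw (C i) (C i₀)
    · rw [hE1 n i h]
      exact (hF n).2.trans h.symm
    · rw [hE2 n i h]
      exact .refl _
  have hEc : ∀ n i, Conn (E n i) := by
    intro n i
    by_cases h : Tw (C i) (C i₀)
    · rw [hE1 n i h]
      exact (hF n).1
    · rw [hE2 n i h]
      exact hC i
  refine ⟨fun _ => ι, E, hEc, fun n x => Or.inl ⟨x, (hEtw n x).2⟩, fun n => ⟨?_, ?_⟩, ?_⟩
  · exact sum_le_inj id Function.injective_id (fun i => (hEtw n i).1)
  · exact sum_le_inj id Function.injective_id (fun i => (hEtw n i).2)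
  · intro n m hne h
    obtain ⟨τ, hτ⟩ := iso_sum (hEc n) (hEc m) h
    have h1 := hτ i₀
    rw [hE1 n i₀ (.refl _)] at h1
    have h2 : Tw (C (τ i₀)) (C i₀) :=
      ((hEtw m (τ i₀)).symm.trans h1.tw.symm).trans (hF n).2
    rw [hE1 m _ h2] at h1
    exact hFn n m hne h1

/-- deleting the image of `k`, remembering adjacency to it by labels -/
abbrev remove {K : Type u} (G : LG L) (k : K → G.V) : LG (L ⊕ K) where
  V := {v : G.V // v ∉ range k}
  Adj a b := G.Adj a.1 b.1
  symm _ _ h := G.symm _ _ h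
  lab a l := Sum.elim (G.lab a.1) (fun c => G.Adj a.1 (k c)) l

def glueAdj (B : LG L) (F : LG (L ⊕ B.V)) : B.V ⊕ F.V → B.V ⊕ F.V → Prop
  | .inl a, .inl b => B.Adj a b
  | .inl a, .inr b => F.lab b (.inr a)
  | .inr a, .inl b => F.lab a (.inr b)
  | .inr a, .inr b => F.Adj a b

abbrev glue (B : LG L) (F : LG (L ⊕ B.V)) : LG L where
  V := B.V ⊕ F.V
  Adj := glueAdj B F
  symm := by
    rintro (a | a) (b | b) h
    · exact B.symm _ _ h
    · exact h
    · exact h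
    · exact F.symm _ _ h
  lab a l := Sum.elim (fun b => B.lab b l) (fun v => F.lab v (.inl l)) a

lemma glue_remove (B H : LG L) (k : B.V → H.V) (hk : Function.Injective k)
    (hadj : ∀ a b, B.Adj a b ↔ H.Adj (k a) (k b)) (hlab : ∀ a l, B.lab a l ↔ H.lab (k a) l) :
    ∃ e, IsIso (glue B (remove H k)) H e ∧ ∀ b, e (Sum.inl b) = k b := by
  let F : B.V ⊕ {v : H.V // v ∉ range k} → H.V := Sum.elim k Subtype.val
  have hF : Function.Bijective F := by
    constructor
    · rintro (a | a) (b | b) h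
      · exact congrArg _ (hk h)
      · exact absurd ⟨a, h⟩ b.2
      · exact absurd ⟨b, h.symm⟩ a.2
      · exact congrArg _ (Subtype.ext h)
    · intro v
      by_cases h : v ∈ range k
      · obtain ⟨b, rfl⟩ := h
        exact ⟨.inl b, rfl⟩
      · exact ⟨.inr ⟨v, h⟩, rfl⟩
  refine ⟨Equiv.ofBijective F hF, ⟨?_, ?_⟩, fun b => rfl⟩
  · rintro (a | a) (b | b)
    · exact hadj a b
    · exact ⟨fun h => H.symm _ _ h, fun h => H.symm _ _ h⟩
    · exact Iff.rfl
    · exact Iff.rfl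
  · rintro (a | a) l
    · exact hlab a l
    · exact Iff.rfl

lemma glue_emb (B : LG L) {F F' : LG (L ⊕ B.V)} {f : F.V → F'.V} (hf : IsEmb F F' f) :
    IsEmb (glue B F) (glue B F') (Sum.map id f) := by
  refine ⟨Function.injective_id.sumMap hf.inj, ?_, ?_⟩
  · rintro (a | a) (b | b) h
    · exact h
    · exact hf.lab _ _ h
    · exact hf.lab _ _ h
    · exact hf.adj _ _ h
  · rintro (a | a) l h
    · exact h
    · exact hf.lab _ _ h

lemma glue_iso (B : LG L) {F F' : LG (L ⊕ B.V)} (h : Iso F F') : Iso (glue B F) (glue B F') := by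
  obtain ⟨e, he⟩ := h
  refine ⟨Equiv.sumCongr (Equiv.refl _) e, ?_, ?_⟩
  · rintro (a | a) (b | b)
    · exact Iff.rfl
    · exact he.lab _ _
    · exact he.lab _ _
    · exact he.adj _ _
  · rintro (a | a) l
    · exact Iff.rfl
    · exact he.lab _ _

lemma iso_of_glue (B : LG L) {F F' : LG (L ⊕ B.V)} (e : B.V ⊕ F.V ≃ B.V ⊕ F'.V)
    (he : IsIso (glue B F) (glue B F') e) (hfix : ∀ b, e (.inl b) = .inl b) : Iso F F' := by
  have h1 : ∀ v, ∃ w, e (.inr v) = .inr w := by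
    intro v
    rcases h : e (.inr v) with b | w
    · rw [← hfix b] at h
      exact absurd (e.injective h) (by simp)
    · exact ⟨w, rfl⟩
  choose q hq using h1
  have hqb : Function.Bijective q := by
    constructor
    · intro a b hab
      have : e (.inr a) = e (.inr b) := by rw [hq, hq, hab]
      exact Sum.inr_injective (e.injective this)
    · intro w
      obtain ⟨v | v, hv⟩ := e.surjective (.inr w)
      · rw [hfix] at hv
        exact absurd hv (by simp)
      · rw [hq] at hv
        exact ⟨v, Sum.inr_injective hv⟩
  refine ⟨Equiv.ofBijective q hqb, ?_, ?_⟩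
  · intro x y
    have := he.adj (.inr x) (.inr y)
    rw [hq, hq] at this
    exact this
  · rintro x (l | b)
    · have := he.lab (.inr x) l
      rw [hq] at this
      exact this
    · have := he.adj (.inr x) (.inl b)
      rw [hq, hfix] at this
      exact this

lemma comp_has_label {K : Type u} {H : LG L} (hH : Conn H) (k : K → H.V) (b₀ : K)
    {D : κ → LG (L ⊕ K)} (hD : ∀ j, Conn (D j)) (hi : Iso (remove H k) (sumG D)) (j : κ) :
    ∃ x b, (D j).lab x (.inr b) := by
  obtain ⟨e, he⟩ := hi
  by_contra hno
  push Not at hno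
  obtain ⟨x⟩ := (hD j).1
  let s : (sumG D).V := ⟨j, x⟩
  have key : ∃ w : {v : H.V // v ∉ range k}, w.1 = k b₀ ∧ (e w).1 = j := by
    refine reach_closed (P := fun v => ∃ w : {v : H.V // v ∉ range k}, w.1 = v ∧ (e w).1 = j) ?_
      (hH.2 (e.symm s).1 (k b₀)) ⟨e.symm s, rfl, ?_⟩
    · rintro _ c ⟨w, rfl, hw⟩ hac
      by_cases hc : c ∈ range k
      · obtain ⟨b, rfl⟩ := hc
        have h1 := (he.lab w (.inr b)).1 hac
        rcases hew : e w with ⟨i, y⟩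
        rw [hew] at hw h1
        dsimp only at hw
        subst hw
        exact absurd h1 (hno y b)
      · refine ⟨⟨c, hc⟩, rfl, ?_⟩
        obtain ⟨i, y, z, h1, h2, -⟩ := (he.adj w ⟨c, hc⟩).1 hac
        have h3 : (e w).1 = i := congrArg Sigma.fst h1
        have h4 : (e ⟨c, hc⟩).1 = i := congrArg Sigma.fst h2
        exact h4.trans (h3.symm.trans hw)
    · rw [e.apply_symm_apply]
  obtain ⟨w, hw, -⟩ := key
  exact w.2 ⟨b₀, hw.symm⟩

lemma iter_emb {G : LG L} {f : G.V → G.V} (hf : IsEmb G G f) (n : ℕ) : IsEmb G G (f^[n]) := by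
  induction n with
  | zero => exact isEmb_id G
  | succ n ih => rw [Function.iterate_succ']; exact hf.comp ih

lemma extract {X : Type*} (r : X → X → Prop) (hr : Equivalence r) (F : ℕ → X)
    (h : ∀ n, {m | r (F m) (F n)}.Finite) :
    ∃ s : ℕ → ℕ, ∀ i j, i ≠ j → ¬ r (F (s i)) (F (s j)) := by
  let S : Setoid ℕ := ⟨fun n m => r (F n) (F m), fun _ => hr.refl _, fun h => hr.symm h,
    fun h h' => hr.trans h h'⟩
  have hinf : Infinite (Quotient S) := by
    by_contra hfin
    rw [not_infinite_iff_finite] at hfin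
    obtain ⟨q, hq⟩ := Finite.exists_infinite_fiber (Quotient.mk S)
    obtain ⟨n, rfl⟩ := Quotient.exists_rep q
    apply Set.infinite_coe_iff.1 hq
    refine (h n).subset ?_
    intro m hm
    exact Quotient.exact (s := S) hm
  let t := Infinite.natEmbedding (Quotient S)
  refine ⟨fun i => (t i).out, fun i j hij hrr => hij (t.injective ?_)⟩
  have : Quotient.mk S (t i).out = Quotient.mk S (t j).out := Quotient.sound (s := S) hrr
  rwa [Quotient.out_eq, Quotient.out_eq] at this

lemma iso_equivalence : Equivalence (Iso (L := L)) := ⟨Iso.refl, Iso.symm, Iso.trans⟩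

lemma conn_step {G : LG L} (hG : Conn G) (hr : Ranked G.Adj)
    (ih : ∀ β < rk G.Adj, ∀ (L' : Type u) (X : LG L'), Conn X → Rk X.Adj β univ → ConnAlt X) :
    ConnAlt G := by
  classical
  rintro H hH ⟨⟨f, hf⟩, g₀, hg₀⟩ hn
  have hkg := ker_good G.symm hr
  obtain ⟨b₀, hb₀⟩ := ker_nonempty G.symm hr hG.connOn
  let K := {v // v ∈ ker G.Adj}
  have hKfin : Finite K := hkg.1
  -- correct `g₀`
  obtain ⟨g, hg, hgf⟩ : ∃ g, IsEmb H G g ∧ ∀ b : K, g (f b.1) = b.1 := by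
    have hφ := hg₀.comp hf
    have hmap : ∀ b : K, (g₀ ∘ f) b.1 ∈ ker G.Adj := fun b =>
      ker_maps hr hφ.inj hφ.adj hφ.inj hφ.adj b.2
    let π₀ : K → K := fun b => ⟨(g₀ ∘ f) b.1, hmap b⟩
    have hπ₀ : Function.Injective π₀ := by
      intro a b hab
      exact Subtype.ext (hφ.inj (congrArg Subtype.val hab))
    let π : Equiv.Perm K := Equiv.ofBijective π₀ (Finite.injective_iff_bijective.1 hπ₀)
    have hit : ∀ n (b : K), ((π ^ n) b).1 = (g₀ ∘ f)^[n] b.1 := by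
      intro n b
      induction n with
      | zero => rfl
      | succ n ihn =>
        rw [pow_succ', Function.iterate_succ_apply', ← ihn]
        rfl
    obtain ⟨m, hm⟩ := Nat.exists_eq_succ_of_ne_zero (orderOf_pos π).ne'
    refine ⟨(g₀ ∘ f)^[m] ∘ g₀, (iter_emb hφ m).comp hg₀, fun b => ?_⟩
    have h1 := hit (orderOf π) b
    rw [pow_orderOf_eq_one, hm] at h1
    exact h1.symm
  let B : LG L := ⟨K, fun a b => G.Adj a.1 b.1, fun _ _ h => G.symm _ _ h, fun a l => G.lab a.1 l⟩
  let k1 : B.V → G.V := Subtype.val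
  let k2 : B.V → H.V := fun b => f b.1
  obtain ⟨eG, heG, heG0⟩ := glue_remove B G k1 Subtype.val_injective (fun _ _ => Iff.rfl)
    (fun _ _ => Iff.rfl)
  obtain ⟨eH, heH, heH0⟩ := glue_remove B H k2 (hf.inj.comp Subtype.val_injective)
    (fun a b => ⟨fun h => hf.adj _ _ h, fun h => by
      have := hg.adj _ _ h
      rwa [hgf, hgf] at this⟩)
    (fun a l => ⟨fun h => hf.lab _ _ h, fun h => by
      have := hg.lab _ _ h
      rwa [hgf] at this⟩)
  have hGH : Tw (remove G k1) (remove H k2) := by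
    constructor
    · refine ⟨fun v => ⟨f v.1, ?_⟩, ?_, ?_, ?_⟩
      · rintro ⟨b, hb⟩
        exact v.2 ⟨b, hf.inj hb⟩
      · intro a b hab
        exact Subtype.ext (hf.inj (congrArg Subtype.val hab))
      · exact fun a b h => hf.adj _ _ h
      · rintro a (l | b) h
        · exact hf.lab _ _ h
        · exact hf.adj _ _ h
    · refine ⟨fun v => ⟨g v.1, ?_⟩, ?_, ?_, ?_⟩
      · rintro ⟨b, hb⟩
        exact v.2 ⟨b, hg.inj ((hgf b).trans hb)⟩
      · intro a b hab
        exact Subtype.ext (hg.inj (congrArg Subtype.val hab))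
      · exact fun a b h => hg.adj _ _ h
      · rintro a (l | b) h
        · exact hg.lab _ _ h
        · have h2 : G.Adj (g a.1) (g (f b.1)) := hg.adj _ _ h
          rw [hgf] at h2
          exact h2
  have hGHn : ¬ Iso (remove G k1) (remove H k2) := fun h =>
    hn ((Iso.symm ⟨eG, heG⟩).trans ((glue_iso B h).trans ⟨eH, heH⟩))
  obtain ⟨ι, C, hC, hCi⟩ := decomp (remove G k1)
  obtain ⟨κ, D, hD, hDi⟩ := decomp (remove H k2)
  have hrG' : Ranked (remove G k1).Adj :=
    hr.comap (f := Subtype.val) Subtype.val_injective (fun _ _ h => h)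
  have hres : Res C D := by
    refine union_step hC hD (ranked_of_le hCi.tw.2 hrG') (hCi.tw.symm.trans (hGH.trans hDi.tw))
      (fun h => hGHn (hCi.trans (h.trans hDi.symm))) ?_
    intro i
    obtain ⟨p, hp⟩ := Le.trans ⟨_, incl_emb C i⟩ hCi.tw.2
    have hpinj : Function.Injective (fun x => (p x).1) := Subtype.val_injective.comp hp.inj
    obtain ⟨β, hβ, hrk⟩ := hkg.2 ((fun x => (p x).1) '' univ) (by
      rintro _ ⟨x, -, rfl⟩
      exact ⟨trivial, fun h => (p x).2 ⟨⟨_, h⟩, rfl⟩⟩) (ConnOn.image (s := G.Adj) (f := fun x => (p x).1) (fun x y h => hp.adj x y h) (hC i).connOn)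
    exact ih β hβ _ (C i) (hC i) (rk_comap hpinj hp.adj β _ _ subset_rfl hrk)
  obtain ⟨X, E, hE1, hE2, hE3, hE4⟩ := hres
  let F : ℕ → LG L := fun n => glue B (sumG (E n))
  have hu : ∀ n, ∃ u, IsEmb G (F n) u ∧ ∀ b : K, u b.1 = Sum.inl b := by
    intro n
    obtain ⟨h, hh⟩ := hCi.tw.1.trans (hE3 n).2
    refine ⟨_, (glue_emb B hh).comp heG.symm.isEmb, fun b => ?_⟩
    have : eG.symm b.1 = Sum.inl b := by
      rw [Equiv.symm_apply_eq]
      exact (heG0 b).symm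
    show Sum.map id h (eG.symm b.1) = _
    rw [this]
    rfl
  have hv : ∀ n, Le (F n) G := by
    intro n
    obtain ⟨h, hh⟩ := (hE3 n).1.trans hCi.tw.2
    exact ⟨_, heG.isEmb.comp (glue_emb B hh)⟩
  choose u hu hu0 using hu
  have hFtw : ∀ n, Tw (F n) G := fun n => ⟨hv n, _, hu n⟩
  have hker : ∀ n, ker (F n).Adj = range Sum.inl := by
    intro n
    obtain ⟨v, hv⟩ := hv n
    rw [← ker_image G.symm hr (F n).symm (hu n).inj (hu n).adj hv.inj hv.adj]
    ext z
    constructor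
    · rintro ⟨b, hb, rfl⟩
      exact ⟨⟨b, hb⟩, (hu0 n ⟨b, hb⟩).symm⟩
    · rintro ⟨b, rfl⟩
      exact ⟨b.1, b.2, hu0 n b⟩
  have hlabel : ∀ n x, ∃ z b, (E n x).lab z (.inr b) := by
    intro n x
    rcases hE2 n x with ⟨i, q, hq⟩ | ⟨j, q, hq⟩
    · obtain ⟨y, b, h⟩ := comp_has_label hG k1 ⟨b₀, hb₀⟩ hC hCi i
      exact ⟨q y, b, hq.lab _ _ h⟩
    · obtain ⟨y, b, h⟩ := comp_has_label hH k2 ⟨b₀, hb₀⟩ hD hDi j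
      exact ⟨q y, b, hq.lab _ _ h⟩
  have hFconn : ∀ n, Conn (F n) := by
    intro n
    let z₀ : (F n).V := Sum.inl ⟨b₀, hb₀⟩
    have hl : ∀ b : K, ReflTransGen (F n).Adj (Sum.inl b) z₀ := by
      intro b
      have this : ReflTransGen (F n).Adj (u n b.1) (u n b₀) :=
        (hG.2 b.1 b₀).lift (u n) (hu n).adj
      have hb : u n b₀ = Sum.inl ⟨b₀, hb₀⟩ := hu0 n ⟨b₀, hb₀⟩
      rw [hu0 n b, hb] at this
      exact this
    have hall : ∀ z : (F n).V, ReflTransGen (F n).Adj z z₀ := by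
      rintro (b | ⟨x, y⟩)
      · exact hl b
      · obtain ⟨z, b, hz⟩ := hlabel n x
        have h1 : ReflTransGen (F n).Adj (Sum.inr ⟨x, y⟩) (Sum.inr ⟨x, z⟩) :=
          ((hE1 n x).2 y z).lift (fun w => (Sum.inr ⟨x, w⟩ : (F n).V))
            (fun a b h => sum_adj.2 h)
        have h2 : (F n).Adj (Sum.inr ⟨x, z⟩) (Sum.inl b) := hz
        exact (h1.tail h2).trans (hl b)
    exact ⟨⟨z₀⟩, fun x y => (hall x).trans (reach_symm (F n).symm (hall y))⟩
  have hfin : ∀ n, {m | Iso (F m) (F n)}.Finite := by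
    intro n
    by_contra hinf
    have hinf' : Infinite {m | Iso (F m) (F n)} := Set.infinite_coe_iff.2 hinf
    have h1 : ∀ m : {m | Iso (F m) (F n)}, ∃ e, IsIso (F m.1) (F n) e := fun m => m.2
    choose e he using h1
    have h2 : ∀ (m : {m | Iso (F m) (F n)}) (b : K), ∃ b' : K, e m (Sum.inl b) = Sum.inl b' := by
      intro m b
      have hrm : Ranked (F m.1).Adj := ranked_of_le (hv m.1) hr
      have := ker_maps hrm (he m).isEmb.inj (he m).isEmb.adj (he m).symm.isEmb.inj
        (he m).symm.isEmb.adj (v := Sum.inl b) (by rw [hker]; exact ⟨b, rfl⟩)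
      rw [hker] at this
      obtain ⟨b', hb'⟩ := this
      exact ⟨b', hb'.symm⟩
    choose π hπ using h2
    obtain ⟨m, m', hne, heq⟩ := Finite.exists_ne_map_eq_of_infinite π
    refine hE4 m.1 m'.1 (fun h => hne (Subtype.ext h))
      (iso_of_glue B ((e m).trans (e m').symm) ((he m).trans (he m').symm) ?_)
    intro b
    show (e m').symm (e m (Sum.inl b)) = Sum.inl b
    rw [Equiv.symm_apply_eq, hπ, hπ, heq]
  obtain ⟨s, hs⟩ := extract Iso iso_equivalence F hfin
  exact ⟨fun i => F (s i), fun i => ⟨hFconn _, hFtw _⟩, hs⟩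

lemma connAlt_of_rk (α : Ordinal.{u}) : ∀ (L : Type u) (G : LG L), Conn G → Rk G.Adj α univ →
    ConnAlt G := by
  induction α using WellFoundedLT.induction with
  | ind α ih =>
    intro L G hG hα
    exact conn_step hG ⟨α, hα⟩ fun β hβ L' X hX hXr =>
      ih β (hβ.trans_le (rk_rk_le hα)) L' X hX hXr

end Labelled

/-- a simple graph as a labelled graph -/
abbrev toLG {V : Type u} (G : SimpleGraph V) : LG PEmpty.{u + 1} :=
  ⟨V, G.Adj, fun _ _ h => h.symm, fun _ l => l.elim⟩

lemma toLG_le {V W : Type u} (G : SimpleGraph V) (H : SimpleGraph W) :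
    Le (toLG G) (toLG H) ↔ ∃ f : G →g H, Function.Injective f := by
  constructor
  · rintro ⟨f, hf⟩
    exact ⟨⟨f, fun h => hf.adj _ _ h⟩, hf.inj⟩
  · rintro ⟨f, hf⟩
    exact ⟨f, hf, fun _ _ h => f.map_adj h, fun _ l => l.elim⟩

lemma toLG_iso {V W : Type u} (G : SimpleGraph V) (H : SimpleGraph W) :
    Iso (toLG G) (toLG H) ↔ Nonempty (G ≃g H) := by
  constructor
  · rintro ⟨e, he⟩
    exact ⟨⟨e, fun {a b} => (he.adj a b).symm⟩⟩
  · rintro ⟨e⟩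
    exact ⟨e.toEquiv, fun _ _ => e.map_adj_iff.symm, fun _ l => l.elim⟩

end RaylessTwins

open RaylessTwins in
/-- A rayless graph has either no weak twin or infinitely many pairwise
non-isomorphic weak twins. -/
theorem rayless_weakTwin_alternative {V : Type u} (G : SimpleGraph V)
    (hG : G.IsRayless) :
    (¬ ∃ (W : Type u) (H : SimpleGraph W), G.WeakTwins H) ∨
    (∃ F : ℕ → Σ W : Type u, SimpleGraph W,
      (∀ i j, i ≠ j → ¬ Nonempty ((F i).2 ≃g (F j).2)) ∧
      ∀ i, G.WeakTwins (F i).2) := by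
  classical
  by_cases hex : ∃ (W : Type u) (H : SimpleGraph W), G.WeakTwins H
  swap
  · exact Or.inl hex
  refine Or.inr ?_
  obtain ⟨W, H, hn, h1, h2⟩ := hex
  have hr : Ranked (toLG G).Adj := ranked_of_rayless (toLG G).symm hG
  have htw : Tw (toLG G) (toLG H) := ⟨(toLG_le _ _).2 h1, (toLG_le _ _).2 h2⟩
  rw [← toLG_iso] at hn
  obtain ⟨ι, C, hC, hCi⟩ := decomp (toLG G)
  obtain ⟨κ, D, hD, hDi⟩ := decomp (toLG H)
  have hrC : Ranked (sumG C).Adj := ranked_of_le hCi.tw.2 hr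
  obtain ⟨X, E, -, -, hE3, hE4⟩ := union_step hC hD hrC
    (hCi.tw.symm.trans (htw.trans hDi.tw)) (fun h => hn (hCi.trans (h.trans hDi.symm)))
    (fun i => by
      obtain ⟨α, hα⟩ := ranked_of_le ⟨_, incl_emb C i⟩ hrC
      exact connAlt_of_rk α _ _ (hC i) hα)
  have hE5 : ∀ n, Tw (sumG (E n)) (toLG G) := fun n => (hE3 n).trans hCi.tw.symm
  let S : ∀ n, SimpleGraph (sumG (E n)).V := fun n =>
    { Adj := (sumG (E n)).Adj
      symm := ⟨(sumG (E n)).symm⟩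
      loopless := ⟨fun x h => by
        obtain ⟨f, hf⟩ := (hE5 n).1
        exact G.loopless.irrefl _ (hf.adj _ _ h)⟩ }
  have hS : ∀ n, Iso (toLG (S n)) (sumG (E n)) := fun n =>
    ⟨Equiv.refl _, fun _ _ => Iff.rfl, fun _ l => l.elim⟩
  have hN : ∃ N, ∀ n, N ≤ n → ¬ Iso (toLG G) (toLG (S n)) := by
    by_cases h : ∃ n, Iso (toLG G) (toLG (S n))
    · obtain ⟨n₀, h₀⟩ := h
      refine ⟨n₀ + 1, fun n hnn h => hE4 n₀ n (by omega) ?_⟩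
      exact (hS n₀).symm.trans (h₀.symm.trans (h.trans (hS n)))
    · exact ⟨0, fun n _ h' => h ⟨n, h'⟩⟩
  obtain ⟨N, hN⟩ := hN
  refine ⟨fun i => ⟨_, S (N + i)⟩, ?_, ?_⟩
  · intro i j hij h
    exact hE4 (N + i) (N + j) (by omega)
      ((hS _).symm.trans (((toLG_iso _ _).2 h).trans (hS _)))
  · intro i
    have ht : Tw (toLG G) (toLG (S (N + i))) := (hE5 _).symm.trans (hS _).symm.tw
    exact ⟨fun h => hN (N + i) (by omega) ((toLG_iso _ _).2 h), (toLG_le _ _).1 ht.1,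
      (toLG_le _ _).1 ht.2⟩
end
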